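/- arXiv:2309.10921 — 2 statements merged into one kernel-verified Lean document; each statement's English description precedes it below -/
import Mathlib

section
/- Fix integers ℓ ≥ 2 and m ≥ 1, and set Q(n) = [ (1/m!)·(n/C(ℓ,2))^m ]^{C(ℓ,2)} · 2^n. Then there exists a constant C > 0 such that for every integer n ≥ 1, (1 − C/n)·Q(n) ≤ s*(n,ℓ,m) ≤ (1 + C/n)·Q(n). -/
open scoped Classical

noncomputable section

/-- The (uniform) `m`-overlapping property. -/
def OverlapU (n ℓ m : ℕ) (F : Fin ℓ → Finset (Finset (Fin n))) : Prop :=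
  ∀ k1 k2 : Fin ℓ, k1 ≠ k2 → ∀ A ∈ F k1, ∀ B ∈ F k2, (A ∩ B).card ≤ m

/-- `s*(n, ℓ, m)`: the maximum of `|𝓕_1|⋯|𝓕_ℓ|` over `m`-overlapping tuples. -/
def sStarU (n ℓ m : ℕ) : ℕ :=
  sSup {P : ℕ | ∃ F : Fin ℓ → Finset (Finset (Fin n)),
    OverlapU n ℓ m F ∧ P = ∏ k, (F k).card}

section Hamming

variable {X L : Type*} [Fintype X] [DecidableEq X] [DecidableEq L]

lemma hammingDist_update_self {c T : X → L} {x : X} (hx : T x ≠ c x) :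
    hammingDist (Function.update T x (c x)) c + 1 = hammingDist T c := by
  unfold hammingDist
  rw [← Finset.card_erase_add_one (s := {i | T i ≠ c i}) (a := x) (by simpa using hx)]
  congr 2
  ext y
  by_cases h : y = x
  · subst h; simp
  · simp [h]

lemma hammingDist_add_of_disjoint {c T T' : X → L} (h : ∀ x, T' x ≠ c x → T x = c x) :
    hammingDist T T' = hammingDist T c + hammingDist T' c := by
  unfold hammingDist
  rw [← Finset.card_union_of_disjoint]
  · congr 1
    ext x
    simp only [Finset.mem_filter, Finset.mem_univ, true_and, Finset.mem_union]
    have := h x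
    grind
  · rw [Finset.disjoint_filter]
    intro x _ h1 h2
    exact h1 (h x h2)

variable [Fintype L] [Nonempty L]

lemma card_hammingBall_le (c : X → L) (r : ℕ) :
    (Finset.univ.filter fun T : X → L => hammingDist T c ≤ r).card
      ≤ (Fintype.card L * (Fintype.card X + 1)) ^ r := by
  induction r with
  | zero =>
    rw [pow_zero, Finset.card_le_one]
    intro a ha b hb
    simp at ha hb
    rw [ha, hb]
  | succ r ih =>
    have hsub : (Finset.univ.filter fun T : X → L => hammingDist T c ≤ r + 1) ⊆
        (Finset.univ.filter fun T : X → L => hammingDist T c ≤ r) ∪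
        ((Finset.univ.filter fun T : X → L => hammingDist T c ≤ r) ×ˢ
          (Finset.univ : Finset (X × L))).image
          (fun z => Function.update z.1 z.2.1 z.2.2) := by
      intro T hT
      simp only [Finset.mem_filter, Finset.mem_univ, true_and] at hT
      by_cases h : T = c
      · simp [h]
      · obtain ⟨x, hx⟩ := Function.ne_iff.mp h
        refine Finset.mem_union_right _ (Finset.mem_image.2
          ⟨(Function.update T x (c x), x, T x), ?_, by simp⟩)
        have := hammingDist_update_self hx
        simp only [Finset.mem_product, Finset.mem_filter, Finset.mem_univ, true_and, and_true]
        omega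
    have h1 : 1 ≤ Fintype.card L := Fintype.card_pos
    calc _ ≤ _ := Finset.card_le_card hsub
      _ ≤ _ := Finset.card_union_le _ _
      _ ≤ _ := Nat.add_le_add_left Finset.card_image_le _
      _ = (Finset.univ.filter fun T : X → L => hammingDist T c ≤ r).card *
          (1 + Fintype.card X * Fintype.card L) := by
        rw [Finset.card_product, Finset.card_univ, Fintype.card_prod]; ring
      _ ≤ _ := by
        rw [pow_succ]
        exact Nat.mul_le_mul ih (by nlinarith)

lemma card_hammingBall_pair_le (c : X → L) (k : ℕ) {x y : X} (hxy : x ≠ y) :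
    (Finset.univ.filter fun T : X → L => hammingDist T c ≤ k ∧ T x ≠ c x ∧ T y ≠ c y).card
      * (Fintype.card X + 1) ^ 2 ≤ (Fintype.card L * (Fintype.card X + 1)) ^ k := by
  have key : ∀ T : X → L, T x ≠ c x → T y ≠ c y →
      hammingDist (Function.update (Function.update T x (c x)) y (c y)) c + 2
        = hammingDist T c := by
    intro T h1 h2
    have h3 := hammingDist_update_self h1
    have h4 := hammingDist_update_self (c := c) (T := Function.update T x (c x)) (x := y)
      (by simpa [hxy.symm] using h2)
    omega
  by_cases hk : 2 ≤ k
  · obtain ⟨r, rfl⟩ := Nat.exists_eq_add_of_le' hk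
    have hsub : (Finset.univ.filter fun T : X → L =>
          hammingDist T c ≤ r + 2 ∧ T x ≠ c x ∧ T y ≠ c y) ⊆
        ((Finset.univ.filter fun T : X → L => hammingDist T c ≤ r) ×ˢ
          (Finset.univ : Finset (L × L))).image
          (fun z => Function.update (Function.update z.1 x z.2.1) y z.2.2) := by
      intro T hT
      simp only [Finset.mem_filter, Finset.mem_univ, true_and] at hT
      obtain ⟨hT, h1, h2⟩ := hT
      refine Finset.mem_image.2
          ⟨(Function.update (Function.update T x (c x)) y (c y), T x, T y), ?_, ?_⟩
      · have := key T h1 h2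
        simp only [Finset.mem_product, Finset.mem_filter, Finset.mem_univ, true_and, and_true]
        omega
      · ext z
        simp only [Function.update_apply]
        grind
    calc _ ≤ ((Fintype.card L * (Fintype.card X + 1)) ^ r * Fintype.card L ^ 2) *
          (Fintype.card X + 1) ^ 2 := by
          refine Nat.mul_le_mul_right _ ((Finset.card_le_card hsub).trans
            (Finset.card_image_le.trans ?_))
          rw [Finset.card_product, Finset.card_univ, Fintype.card_prod, ← pow_two]
          exact Nat.mul_le_mul_right _ (card_hammingBall_le c r)
      _ = _ := by ring
  · rw [Finset.card_eq_zero.2]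
    · simp
    · rw [Finset.filter_eq_empty_iff]
      rintro T - ⟨h, h1, h2⟩
      have := key T h1 h2
      omega

/-- A large family of diameter at most `2 * k` lies in a ball of radius `k` around a center
from which its members deviate generically. -/
lemma exists_generic_center (k : ℕ) (hk : 1 ≤ k) (F : Finset (X → L))
    (hF : ∀ T ∈ F, ∀ T' ∈ F, hammingDist T T' ≤ 2 * k)
    (hbig : 2 * (8 * k * Fintype.card L) ^ (2 * k) *
      (Fintype.card L * (Fintype.card X + 1)) ^ (k - 1) < F.card) :
    ∃ c : X → L, (∀ x, ∃ T ∈ F, c x = T x) ∧ (∀ T ∈ F, hammingDist T c ≤ k) ∧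
      ∀ Y : Finset X, Y.card ≤ 4 * k →
        ∃ T ∈ F, hammingDist T c = k ∧ ∀ x ∈ Y, T x = c x := by
  obtain ⟨T₀, hT₀⟩ : F.Nonempty := Finset.card_pos.1 (by omega)
  have hq : 1 ≤ Fintype.card L := Fintype.card_pos
  set R := 8 * k * Fintype.card L with hR
  have hR1 : 1 ≤ R := by rw [hR]; exact Nat.mul_pos (by omega) hq
  let G : (X → L) → Finset (X → L) := fun c => F.filter fun T => ∀ x, c x ≠ T₀ x → T x = c x
  obtain ⟨c, -, hc⟩ := Finset.exists_max_image (Finset.univ : Finset (X → L))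
    (fun c => (G c).card * R ^ hammingDist c T₀) ⟨T₀, Finset.mem_univ _⟩
  have hGT₀ : G T₀ = F := by simp [G]
  have hcF : F.card ≤ (G c).card * R ^ hammingDist c T₀ := by
    simpa [hGT₀] using hc T₀ (Finset.mem_univ _)
  have hGpos : 0 < (G c).card := by
    by_contra h
    have : (G c).card = 0 := by omega
    rw [this] at hcF
    omega
  obtain ⟨T₁, hT₁⟩ := Finset.card_pos.1 hGpos
  have hT₁' := (Finset.mem_filter.1 hT₁)
  have hcd : hammingDist c T₀ ≤ 2 * k := by
    refine le_trans ?_ (hF T₁ hT₁'.1 T₀ hT₀)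
    unfold hammingDist
    refine Finset.card_le_card fun x hx => ?_
    simp only [Finset.mem_filter, Finset.mem_univ, true_and] at hx ⊢
    rw [hT₁'.2 x hx]; exact hx
  have hGbig : F.card ≤ (G c).card * R ^ (2 * k) :=
    hcF.trans (Nat.mul_le_mul_left _ (Nat.pow_le_pow_right hR1 hcd))
  have hrare : ∀ x v, v ≠ c x → R * ((G c).filter fun T => T x = v).card ≤ (G c).card := by
    intro x v hv
    by_cases hx : c x = T₀ x
    · have h1 := hc (Function.update c x v) (Finset.mem_univ _)
      have hd : hammingDist (Function.update c x v) T₀ = hammingDist c T₀ + 1 := by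
        have := hammingDist_update_self (c := T₀) (T := Function.update c x v) (x := x)
          (by simpa [← hx] using hv)
        rw [← this, ← hx]
        simp
      have hG : G (Function.update c x v) = (G c).filter fun T => T x = v := by
        ext T
        simp only [G, Finset.mem_filter, Function.update_apply]
        grind
      simp only [hd, hG, pow_succ] at h1
      have hpos : 0 < R ^ hammingDist c T₀ := Nat.pow_pos hR1
      refine Nat.le_of_mul_le_mul_right ?_ hpos
      linarith
    · rw [Finset.card_eq_zero.2]
      · simp
      · rw [Finset.filter_eq_empty_iff]
        intro T hT h
        exact hv (h.symm.trans ((Finset.mem_filter.1 hT).2 x hx))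
  have hgen : ∀ Y : Finset X, Y.card ≤ 4 * k →
        ∃ T ∈ F, k ≤ hammingDist T c ∧ ∀ x ∈ Y, T x = c x := by
    intro Y hY
    by_contra! hcon
    have hsub : G c ⊆ (Finset.univ.filter fun T : X → L => hammingDist T c ≤ k - 1) ∪
        (Y ×ˢ (Finset.univ : Finset L)).biUnion
          (fun z => (G c).filter fun T => T z.1 = z.2 ∧ z.2 ≠ c z.1) := by
      intro T hT
      by_cases h : hammingDist T c ≤ k - 1
      · exact Finset.mem_union_left _ (by simpa using h)
      · obtain ⟨x, hx, hne⟩ := hcon T (Finset.mem_filter.1 hT).1 (by omega)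
        refine Finset.mem_union_right _ (Finset.mem_biUnion.2 ⟨(x, T x), ?_, ?_⟩)
        · simpa using hx
        · simp [hT, hne]
    have h1 := (Finset.card_le_card hsub).trans (Finset.card_union_le _ _)
    have h2 := card_hammingBall_le c (k - 1)
    have h3 : R * ((Y ×ˢ (Finset.univ : Finset L)).biUnion
          (fun z => (G c).filter fun T => T z.1 = z.2 ∧ z.2 ≠ c z.1)).card ≤
          (4 * k * Fintype.card L) * (G c).card := by
      refine (Nat.mul_le_mul_left _ Finset.card_biUnion_le).trans ?_
      rw [Finset.mul_sum]
      refine (Finset.sum_le_card_nsmul _ _ (G c).card ?_).trans ?_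
      · rintro ⟨x, v⟩ -
        by_cases hv : v = c x
        · simp [hv]
        · simpa [hv] using hrare x v hv
      · rw [Finset.card_product, Finset.card_univ, smul_eq_mul]
        gcongr
    have h4 : 2 * ((Y ×ˢ (Finset.univ : Finset L)).biUnion
          (fun z => (G c).filter fun T => T z.1 = z.2 ∧ z.2 ≠ c z.1)).card ≤ (G c).card := by
      refine le_of_mul_le_mul_left (a := 4 * k * Fintype.card L) ?_
        (Nat.mul_pos (by omega) hq)
      refine le_trans (le_of_eq ?_) h3
      rw [hR]; ring
    have h5 : (G c).card ≤ 2 * (Fintype.card L * (Fintype.card X + 1)) ^ (k - 1) := by omega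
    have := Nat.mul_le_mul_right (R ^ (2 * k)) h5
    nlinarith
  have hle : ∀ T ∈ F, hammingDist T c ≤ k := by
    intro T hT
    obtain ⟨T', hT', hd, hdis⟩ := hgen (Finset.univ.filter fun x => T x ≠ c x) (by
      have h1 := hammingDist_triangle T T₀ c
      have h2 := hF T hT T₀ hT₀
      rw [hammingDist_comm T₀ c] at h1
      change hammingDist T c ≤ _
      omega)
    have h1 := hammingDist_add_of_disjoint (c := c) (T := T') (T' := T) (by simpa using hdis)
    have h2 := hF T' hT' T hT
    omega
  refine ⟨c, fun x => ?_, hle, fun Y hY => ?_⟩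
  · by_cases hx : c x = T₀ x
    · exact ⟨T₀, hT₀, hx⟩
    · exact ⟨T₁, hT₁'.1, (hT₁'.2 x hx).symm⟩
  · obtain ⟨T, hT, hd, h⟩ := hgen Y hY
    exact ⟨T, hT, le_antisymm (hle T hT) hd, h⟩

end Hamming

section Fiber

variable {X : Type*} [Fintype X] {ℓ m : ℕ}

/-- Any two (possibly equal) members of `F`, read as tuples of sets indexed by `Fin ℓ`,
have at most `m` common points in any two distinct positions. -/
def CrossBounded (m : ℕ) (F : Finset (X → Finset (Fin ℓ))) : Prop :=
  ∀ T ∈ F, ∀ T' ∈ F, ∀ i j, i ≠ j →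
    (Finset.univ.filter fun x => i ∈ T x ∧ j ∈ T' x).card ≤ m

lemma sum_cross_eq (T T' : X → Finset (Fin ℓ)) :
    ∑ z ∈ (Finset.univ : Finset (Fin ℓ)).offDiag,
      (Finset.univ.filter fun x => z.1 ∈ T x ∧ z.2 ∈ T' x).card =
    ∑ x, ((Finset.univ : Finset (Fin ℓ)).offDiag.filter
      fun z => z.1 ∈ T x ∧ z.2 ∈ T' x).card := by
  simp only [Finset.card_filter]
  exact Finset.sum_comm

lemma card_offDiag_fin (ℓ : ℕ) :
    (Finset.univ : Finset (Fin ℓ)).offDiag.card = 2 * ℓ.choose 2 := by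
  rw [Finset.offDiag_card, Finset.card_univ, Fintype.card_fin, Nat.choose_two_right,
    Nat.mul_div_cancel' (Nat.even_mul_pred_self ℓ).two_dvd, Nat.mul_sub, mul_one]

lemma one_le_card_cross {A B : Finset (Fin ℓ)} (hA : A.Nonempty) (hB : B.Nonempty)
    (h : A ≠ B) : 1 ≤ ((Finset.univ : Finset (Fin ℓ)).offDiag.filter
      fun z => z.1 ∈ A ∧ z.2 ∈ B).card := by
  rw [Nat.one_le_iff_ne_zero, ← Nat.pos_iff_ne_zero, Finset.card_pos]
  obtain ⟨i, hi⟩ : ∃ i, ¬ (i ∈ A ↔ i ∈ B) := by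
    by_contra! hcon
    exact h (Finset.ext hcon)
  by_cases hiA : i ∈ A
  · obtain ⟨j, hj⟩ := hB
    exact ⟨(i, j), by simp; grind⟩
  · obtain ⟨j, hj⟩ := hA
    exact ⟨(j, i), by simp; grind⟩

lemma hammingDist_le_sum_cross {T T' : X → Finset (Fin ℓ)} (hT : ∀ x, (T x).Nonempty)
    (hT' : ∀ x, (T' x).Nonempty) :
    hammingDist T T' ≤ ∑ x, ((Finset.univ : Finset (Fin ℓ)).offDiag.filter
      fun z => z.1 ∈ T x ∧ z.2 ∈ T' x).card := by
  unfold hammingDist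
  rw [Finset.card_filter]
  refine Finset.sum_le_sum fun x _ => ?_
  split_ifs with h
  · exact one_le_card_cross (hT x) (hT' x) h
  · exact Nat.zero_le _

lemma CrossBounded.sum_le {F : Finset (X → Finset (Fin ℓ))} (h : CrossBounded m F)
    {T T' : X → Finset (Fin ℓ)} (hT : T ∈ F) (hT' : T' ∈ F) :
    ∑ z ∈ (Finset.univ : Finset (Fin ℓ)).offDiag,
      (Finset.univ.filter fun x => z.1 ∈ T x ∧ z.2 ∈ T' x).card ≤ 2 * (ℓ.choose 2 * m) := by
  refine (Finset.sum_le_card_nsmul _ _ m fun z hz =>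
    h T hT T' hT' z.1 z.2 (Finset.mem_offDiag.1 hz).2.2).trans ?_
  rw [card_offDiag_fin, smul_eq_mul, mul_assoc]

/-- If two members are at the largest possible distance, then all cross intersections
have size exactly `m`. -/
lemma CrossBounded.card_eq_of_hammingDist_eq {F : Finset (X → Finset (Fin ℓ))}
    (h : CrossBounded m F) (hF : ∀ T ∈ F, ∀ x, (T x).Nonempty) {T T' : X → Finset (Fin ℓ)}
    (hT : T ∈ F) (hT' : T' ∈ F) (hd : hammingDist T T' = 2 * (ℓ.choose 2 * m))
    {i j : Fin ℓ} (hij : i ≠ j) :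
    (Finset.univ.filter fun x => i ∈ T x ∧ j ∈ T' x).card = m := by
  have h1 := hammingDist_le_sum_cross (hF T hT) (hF T' hT')
  rw [← sum_cross_eq, hd] at h1
  have h2 : ∑ z ∈ (Finset.univ : Finset (Fin ℓ)).offDiag,
      (Finset.univ.filter fun x => z.1 ∈ T x ∧ z.2 ∈ T' x).card =
      ∑ z ∈ (Finset.univ : Finset (Fin ℓ)).offDiag, m := by
    rw [Finset.sum_const, card_offDiag_fin, smul_eq_mul, mul_assoc]
    exact le_antisymm (h.sum_le hT hT') h1
  exact (Finset.sum_eq_sum_iff_of_le fun z hz =>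
    h T hT T' hT' z.1 z.2 (Finset.mem_offDiag.1 hz).2.2).1 h2 (i, j) (by simpa using hij)

lemma CrossBounded.eq_of_hammingDist_eq {F : Finset (X → Finset (Fin ℓ))}
    (h : CrossBounded m F) (hF : ∀ T ∈ F, ∀ x, (T x).Nonempty) {T T' : X → Finset (Fin ℓ)}
    (hT : T ∈ F) (hT' : T' ∈ F) (hd : hammingDist T T' = 2 * (ℓ.choose 2 * m))
    {x : X} (hx : T x = T' x) {i j : Fin ℓ} (hi : i ∈ T x) (hj : j ∈ T x) : i = j := by
  by_contra hij
  have h1 := h.sum_le hT hT'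
  rw [sum_cross_eq, ← hd] at h1
  refine absurd h1 (not_le.2 ?_)
  unfold hammingDist
  rw [Finset.card_filter]
  refine Finset.sum_lt_sum (fun y _ => ?_) ⟨x, Finset.mem_univ _, ?_⟩
  · split_ifs with hy
    · exact one_le_card_cross (hF T hT y) (hF T' hT' y) hy
    · exact Nat.zero_le _
  · rw [if_neg (not_not.2 hx), Finset.card_pos]
    exact ⟨(i, j), by simp [hij, hi, ← hx, hj]⟩

/-- The number of points where the center label `i` is joined or replaced by `j`. -/
def transfer (a : X → Fin ℓ) (T : X → Finset (Fin ℓ)) (i j : Fin ℓ) : ℕ :=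
  (Finset.univ.filter fun x => a x = i ∧ j ∈ T x).card

section Structure

variable {F : Finset (X → Finset (Fin ℓ))} {a : X → Fin ℓ}

lemma CrossBounded.transfer_add_of_disjoint (h : CrossBounded m F)
    (hF : ∀ T ∈ F, ∀ x, (T x).Nonempty) {T T' : X → Finset (Fin ℓ)} (hT : T ∈ F) (hT' : T' ∈ F)
    (hd : hammingDist T (fun x => {a x}) = ℓ.choose 2 * m)
    (hd' : hammingDist T' (fun x => {a x}) = ℓ.choose 2 * m)
    (hdis : ∀ x, T' x ≠ {a x} → T x = {a x}) {i j : Fin ℓ} (hij : i ≠ j) :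
    transfer a T j i + transfer a T' i j = m := by
  have h1 := hammingDist_add_of_disjoint (c := fun x => {a x}) (T := T) (T' := T') hdis
  have h2 := h.card_eq_of_hammingDist_eq hF hT hT' (by omega) hij
  rw [← h2, transfer, transfer, ← Finset.card_union_of_disjoint]
  · congr 1
    ext x
    simp only [Finset.mem_union, Finset.mem_filter, Finset.mem_univ, true_and]
    have := hdis x
    by_cases h3 : T' x = {a x}
    · by_cases h4 : T x = {a x}
      · simp only [h3, h4, Finset.mem_singleton]; grind
      · simp only [h3, Finset.mem_singleton]; grind
    · simp only [this h3, Finset.mem_singleton]; grind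
  · rw [Finset.disjoint_filter]
    rintro x - ⟨h3, -⟩ ⟨h4, -⟩
    exact hij (h4.symm.trans h3)

lemma CrossBounded.transfer_eq (h : CrossBounded m F)
    (hF : ∀ T ∈ F, ∀ x, (T x).Nonempty)
    (hgen : ∀ Y : Finset X, Y.card ≤ 4 * (ℓ.choose 2 * m) →
      ∃ T ∈ F, hammingDist T (fun x => {a x}) = ℓ.choose 2 * m ∧ ∀ x ∈ Y, T x = {a x})
    {T T' : X → Finset (Fin ℓ)} (hT : T ∈ F) (hT' : T' ∈ F)
    (hd : hammingDist T (fun x => {a x}) = ℓ.choose 2 * m)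
    (hd' : hammingDist T' (fun x => {a x}) = ℓ.choose 2 * m)
    {i j : Fin ℓ} (hij : i ≠ j) : transfer a T i j = transfer a T' i j := by
  obtain ⟨U, hU, hUd, hUY⟩ := hgen ((Finset.univ.filter fun x => T x ≠ {a x}) ∪
      (Finset.univ.filter fun x => T' x ≠ {a x})) (by
    refine (Finset.card_union_le _ _).trans ?_
    change hammingDist T (fun x => {a x}) + hammingDist T' (fun x => {a x}) ≤ _
    omega)
  have h1 := h.transfer_add_of_disjoint hF hU hT hUd hd
    (fun x hx => hUY x (by simp [hx])) hij
  have h2 := h.transfer_add_of_disjoint hF hU hT' hUd hd'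
    (fun x hx => hUY x (by simp [hx])) hij
  omega

lemma CrossBounded.transfer_add (h : CrossBounded m F)
    (hF : ∀ T ∈ F, ∀ x, (T x).Nonempty)
    (hgen : ∀ Y : Finset X, Y.card ≤ 4 * (ℓ.choose 2 * m) →
      ∃ T ∈ F, hammingDist T (fun x => {a x}) = ℓ.choose 2 * m ∧ ∀ x ∈ Y, T x = {a x})
    {T T' : X → Finset (Fin ℓ)} (hT : T ∈ F) (hT' : T' ∈ F)
    (hd : hammingDist T (fun x => {a x}) = ℓ.choose 2 * m)
    (hd' : hammingDist T' (fun x => {a x}) = ℓ.choose 2 * m)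
    {i j : Fin ℓ} (hij : i ≠ j) : transfer a T j i + transfer a T' i j = m := by
  obtain ⟨U, hU, hUd, hUY⟩ := hgen (Finset.univ.filter fun x => T' x ≠ {a x}) (by
    change hammingDist T' (fun x => {a x}) ≤ _
    omega)
  rw [h.transfer_eq hF hgen hT hU hd hUd hij.symm]
  exact h.transfer_add_of_disjoint hF hU hT' hUd hd' (fun x hx => hUY x (by simpa using hx)) hij

/-- Two members that move the same point `x` to different labels deviate from the center
at a further common point. -/
lemma exists_common_deviation (h : CrossBounded m F) {T T' : X → Finset (Fin ℓ)} (hT : T ∈ F)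
    (hT' : T' ∈ F) {x : X} {b b' : Fin ℓ} (hbb : b ≠ b') (hb : b ≠ a x) (hb' : b' ≠ a x)
    (hbT : b ∈ T x) (hbT' : b' ∈ T' x) (hsum : transfer a T b' b + transfer a T' b b' = m) :
    ∃ y, x ≠ y ∧ T y ≠ {a y} ∧ T' y ≠ {a y} := by
  by_contra! hcon
  have h1 := h T hT T' hT' b b' hbb
  have hsub : insert x ((Finset.univ.filter fun y => a y = b' ∧ b ∈ T y) ∪
      (Finset.univ.filter fun y => a y = b ∧ b' ∈ T' y)) ⊆
      (Finset.univ.filter fun x => b ∈ T x ∧ b' ∈ T' x) := by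
    intro y hy
    simp only [Finset.mem_insert, Finset.mem_union, Finset.mem_filter, Finset.mem_univ,
      true_and] at hy ⊢
    rcases hy with rfl | ⟨rfl, h2⟩ | ⟨rfl, h2⟩
    · exact ⟨hbT, hbT'⟩
    · refine ⟨h2, ?_⟩
      rw [hcon y (by rintro rfl; exact hb' rfl) (by intro h3; simp [h3] at h2; exact hbb h2)]
      simp
    · refine ⟨?_, h2⟩
      by_contra h4
      have h5 : T y ≠ {a y} := by intro h3; simp [h3] at h4
      have h6 := hcon y (by rintro rfl; exact hb rfl) h5
      simp [h6] at h2
      exact hbb h2.symm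
  have h2 := Finset.card_le_card hsub
  rw [Finset.card_insert_of_notMem, Finset.card_union_of_disjoint] at h2
  · unfold transfer at hsum
    omega
  · rw [Finset.disjoint_filter]
    rintro y - ⟨h3, -⟩ ⟨h4, -⟩
    exact hbb (h4.symm.trans h3)
  · simp only [Finset.mem_union, Finset.mem_filter, Finset.mem_univ, true_and]
    grind

/-- The members at distance `k` from the center whose value at `x` contains `b`. -/
def deviating (F : Finset (X → Finset (Fin ℓ))) (a : X → Fin ℓ) (k : ℕ) (x : X) (b : Fin ℓ) :
    Finset (X → Finset (Fin ℓ)) :=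
  F.filter fun T => hammingDist T (fun x => {a x}) = k ∧ b ∈ T x

/-- `b` is a label moved to `x` by many members. -/
def Heavy (F : Finset (X → Finset (Fin ℓ))) (a : X → Fin ℓ) (k : ℕ) (x : X) (b : Fin ℓ) : Prop :=
  b ≠ a x ∧ k * (Fintype.card (Finset (Fin ℓ)) * (Fintype.card X + 1)) ^ k <
    (deviating F a k x b).card * (Fintype.card X + 1) ^ 2

/-- The points whose center label together with a heavy label forms `e`. -/
def heavyPart (F : Finset (X → Finset (Fin ℓ))) (a : X → Fin ℓ) (k : ℕ) (e : Finset (Fin ℓ)) :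
    Finset X :=
  Finset.univ.filter fun x => ∃ b, Heavy F a k x b ∧ e = {a x, b}

/-- The members at distance `k` from the center all of whose deviations are heavy. -/
def regularPart (F : Finset (X → Finset (Fin ℓ))) (a : X → Fin ℓ) (k : ℕ) :
    Finset (X → Finset (Fin ℓ)) :=
  F.filter fun T => hammingDist T (fun x => {a x}) = k ∧
    ∀ x b, b ∈ T x → b ≠ a x → Heavy F a k x b

lemma CrossBounded.eq_of_heavy (h : CrossBounded m F)
    (hF : ∀ T ∈ F, ∀ x, (T x).Nonempty)
    (hgen : ∀ Y : Finset X, Y.card ≤ 4 * (ℓ.choose 2 * m) →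
      ∃ T ∈ F, hammingDist T (fun x => {a x}) = ℓ.choose 2 * m ∧ ∀ x ∈ Y, T x = {a x})
    {T : X → Finset (Fin ℓ)} (hT : T ∈ F)
    (hd : hammingDist T (fun x => {a x}) = ℓ.choose 2 * m) {x : X} {b b' : Fin ℓ}
    (hb : b ≠ a x) (hbT : b ∈ T x) (hb' : Heavy F a (ℓ.choose 2 * m) x b') : b = b' := by
  by_contra hbb
  set k := ℓ.choose 2 * m with hk
  have hsub : deviating F a k x b' ⊆
      ((Finset.univ.filter fun y => T y ≠ {a y}).erase x).biUnion fun y =>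
        Finset.univ.filter fun T' : X → Finset (Fin ℓ) =>
          hammingDist T' (fun x => {a x}) ≤ k ∧ T' x ≠ {a x} ∧ T' y ≠ {a y} := by
    intro T' hT'
    obtain ⟨hT'F, hd', hbT'⟩ := Finset.mem_filter.1 hT'
    obtain ⟨y, hxy, h1, h2⟩ := exists_common_deviation h hT hT'F hbb hb hb'.1 hbT hbT'
      (h.transfer_add hF hgen hT hT'F hd hd' hbb)
    simp only [Finset.mem_biUnion, Finset.mem_erase, Finset.mem_filter, Finset.mem_univ,
      true_and]
    refine ⟨y, ⟨hxy.symm, h1⟩, hd'.le, ?_, h2⟩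
    intro h3
    rw [h3, Finset.mem_singleton] at hbT'
    exact hb'.1 hbT'
  refine absurd hb'.2 (not_lt.2 ?_)
  refine (Nat.mul_le_mul_right _ ((Finset.card_le_card hsub).trans
    Finset.card_biUnion_le)).trans ?_
  rw [Finset.sum_mul]
  refine (Finset.sum_le_card_nsmul _ _
    ((Fintype.card (Finset (Fin ℓ)) * (Fintype.card X + 1)) ^ k) fun y hy => ?_).trans ?_
  · exact card_hammingBall_pair_le (fun x => {a x}) k (Finset.ne_of_mem_erase hy).symm
  · rw [smul_eq_mul]
    refine Nat.mul_le_mul_right _ ((Finset.card_le_card (Finset.erase_subset _ _)).trans ?_)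
    exact hd.le

lemma CrossBounded.heavy_unique (h : CrossBounded m F)
    (hF : ∀ T ∈ F, ∀ x, (T x).Nonempty)
    (hgen : ∀ Y : Finset X, Y.card ≤ 4 * (ℓ.choose 2 * m) →
      ∃ T ∈ F, hammingDist T (fun x => {a x}) = ℓ.choose 2 * m ∧ ∀ x ∈ Y, T x = {a x})
    {x : X} {b b' : Fin ℓ} (hb : Heavy F a (ℓ.choose 2 * m) x b)
    (hb' : Heavy F a (ℓ.choose 2 * m) x b') : b = b' := by
  have h1 : 0 < (deviating F a (ℓ.choose 2 * m) x b).card := by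
    by_contra h0
    have h2 : (deviating F a (ℓ.choose 2 * m) x b).card = 0 := by omega
    have h3 := hb.2
    rw [h2, zero_mul] at h3
    omega
  obtain ⟨T, hT⟩ := Finset.card_pos.1 h1
  obtain ⟨hTF, hd, hbT⟩ := Finset.mem_filter.1 hT
  exact h.eq_of_heavy hF hgen hTF hd hb.1 hbT hb'

lemma card_le_card_regularPart_add (hk : ∀ T ∈ F, hammingDist T (fun x => {a x}) ≤ m)
    (hm : 1 ≤ m) : F.card ≤ (regularPart F a m).card +
      (1 + ℓ * m * Fintype.card (Finset (Fin ℓ))) * Fintype.card (Finset (Fin ℓ)) ^ (m - 1) *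
        (Fintype.card X + 1) ^ (m - 1) := by
  set q := Fintype.card (Finset (Fin ℓ))
  set N := Fintype.card X
  let I : Finset (X × Fin ℓ) :=
    Finset.univ.filter fun z => z.2 ≠ a z.1 ∧ ¬ Heavy F a m z.1 z.2
  have hsub : F ⊆ regularPart F a m ∪
      ((Finset.univ.filter fun T : X → Finset (Fin ℓ) =>
        hammingDist T (fun x => {a x}) ≤ m - 1) ∪
        I.biUnion fun z => deviating F a m z.1 z.2) := by
    intro T hT
    simp only [Finset.mem_union, regularPart, deviating, I, Finset.mem_biUnion,
      Finset.mem_filter, Finset.mem_univ, true_and, Prod.exists]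
    have := hk T hT
    by_cases h1 : hammingDist T (fun x => {a x}) = m
    · by_cases h2 : ∀ x b, b ∈ T x → b ≠ a x → Heavy F a m x b
      · exact Or.inl ⟨hT, h1, h2⟩
      · push Not at h2
        obtain ⟨x, b, h3, h4, h5⟩ := h2
        exact Or.inr (Or.inr ⟨x, b, ⟨h4, h5⟩, hT, h1, h3⟩)
    · exact Or.inr (Or.inl (by omega))
  have h1 := card_hammingBall_le (fun x : X => ({a x} : Finset (Fin ℓ))) (m - 1)
  have h2 : (I.biUnion fun z => deviating F a m z.1 z.2).card ≤
      ℓ * m * q ^ m * (N + 1) ^ (m - 1) := by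
    refine Nat.le_of_mul_le_mul_right (c := (N + 1) ^ 2) ?_ (by positivity)
    refine (Nat.mul_le_mul_right _ Finset.card_biUnion_le).trans ?_
    rw [Finset.sum_mul]
    refine (Finset.sum_le_card_nsmul _ _ (m * (q * (N + 1)) ^ m) fun z hz => ?_).trans ?_
    · obtain ⟨-, hz1, hz2⟩ := Finset.mem_filter.1 hz
      by_contra hcon
      exact hz2 ⟨hz1, not_le.1 hcon⟩
    · have hI : I.card ≤ (N + 1) * ℓ := by
        refine (Finset.card_le_univ I).trans ?_
        rw [Fintype.card_prod, Fintype.card_fin]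
        exact Nat.mul_le_mul_right _ (Nat.le_succ _)
      rw [smul_eq_mul]
      refine (Nat.mul_le_mul_right _ hI).trans (le_of_eq ?_)
      obtain ⟨r, rfl⟩ := Nat.exists_eq_add_of_le' hm
      rw [Nat.add_sub_cancel, mul_pow]
      ring
  have h3 := Finset.card_le_card hsub
  have h4 := Finset.card_union_le (regularPart F a m)
    ((Finset.univ.filter fun T : X → Finset (Fin ℓ) =>
        hammingDist T (fun x => {a x}) ≤ m - 1) ∪ I.biUnion fun z => deviating F a m z.1 z.2)
  have h5 := Finset.card_union_le (Finset.univ.filter fun T : X → Finset (Fin ℓ) =>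
        hammingDist T (fun x => {a x}) ≤ m - 1) (I.biUnion fun z => deviating F a m z.1 z.2)
  have h6 : (1 + ℓ * m * q) * q ^ (m - 1) * (N + 1) ^ (m - 1) =
      (q * (N + 1)) ^ (m - 1) + ℓ * m * q ^ m * (N + 1) ^ (m - 1) := by
    obtain ⟨r, rfl⟩ := Nat.exists_eq_add_of_le' hm
    rw [Nat.add_sub_cancel, mul_pow]
    ring
  rw [h6]
  change _ ≤ (q * (N + 1)) ^ (m - 1) at h1
  omega

/-- The positions inside `heavyPart` where a regular member deviates, together with those
where it keeps the center label. -/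
def deviationCode (F : Finset (X → Finset (Fin ℓ))) (a : X → Fin ℓ) (k : ℕ)
    (T : X → Finset (Fin ℓ)) (e : Finset (Fin ℓ)) : (_ : Finset X) × Finset X :=
  ⟨(heavyPart F a k e).filter fun x => T x ≠ {a x},
    (heavyPart F a k e).filter fun x => T x ≠ {a x} ∧ a x ∈ T x⟩

lemma CrossBounded.card_deviation_eq (h : CrossBounded m F)
    (hF : ∀ T ∈ F, ∀ x, (T x).Nonempty)
    (hgen : ∀ Y : Finset X, Y.card ≤ 4 * (ℓ.choose 2 * m) →
      ∃ T ∈ F, hammingDist T (fun x => {a x}) = ℓ.choose 2 * m ∧ ∀ x ∈ Y, T x = {a x})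
    {T : X → Finset (Fin ℓ)} (hT : T ∈ regularPart F a (ℓ.choose 2 * m))
    {e : Finset (Fin ℓ)} (he : e.card = 2) :
    ((heavyPart F a (ℓ.choose 2 * m) e).filter fun x => T x ≠ {a x}).card = m := by
  obtain ⟨hTF, hd, hreg⟩ := Finset.mem_filter.1 hT
  obtain ⟨i, j, hij, rfl⟩ := Finset.card_eq_two.1 he
  refine Eq.trans ?_ (h.transfer_add hF hgen hTF hTF hd hd hij)
  rw [transfer, transfer, ← Finset.card_union_of_disjoint]
  · congr 1
    ext x
    simp only [heavyPart, Finset.mem_union, Finset.mem_filter, Finset.mem_univ, true_and]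
    constructor
    · rintro ⟨⟨b, hb, he⟩, hne⟩
      have hbT : b ∈ T x := by
        obtain ⟨b', hb', hne'⟩ : ∃ b' ∈ T x, b' ≠ a x := by
          by_contra! hcon
          exact hne ((hF T hTF x).subset_singleton_iff.1 fun b' hb' => by simp [hcon b' hb'])
        exact h.heavy_unique hF hgen (hreg x b' hb' hne') hb ▸ hb'
      have hba := hb.1
      have hi : i ∈ ({a x, b} : Finset (Fin ℓ)) := he ▸ (by simp)
      have hj : j ∈ ({a x, b} : Finset (Fin ℓ)) := he ▸ (by simp)
      simp only [Finset.mem_insert, Finset.mem_singleton] at hi hj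
      grind
    · rintro (⟨rfl, hi⟩ | ⟨rfl, hj⟩)
      · exact ⟨⟨i, hreg x i hi hij, Finset.pair_comm _ _⟩, fun h0 => by
          rw [h0, Finset.mem_singleton] at hi; exact hij hi⟩
      · exact ⟨⟨j, hreg x j hj hij.symm, rfl⟩, fun h0 => by
          rw [h0, Finset.mem_singleton] at hj; exact hij hj.symm⟩
  · rw [Finset.disjoint_filter]
    rintro x - ⟨h3, -⟩ ⟨h4, -⟩
    exact hij (h4.symm.trans h3)

lemma CrossBounded.deviationCode_injOn (h : CrossBounded m F)
    (hF : ∀ T ∈ F, ∀ x, (T x).Nonempty)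
    (hgen : ∀ Y : Finset X, Y.card ≤ 4 * (ℓ.choose 2 * m) →
      ∃ T ∈ F, hammingDist T (fun x => {a x}) = ℓ.choose 2 * m ∧ ∀ x ∈ Y, T x = {a x})
    {T T' : X → Finset (Fin ℓ)} (hT : T ∈ regularPart F a (ℓ.choose 2 * m))
    (hT' : T' ∈ regularPart F a (ℓ.choose 2 * m))
    (hcode : ∀ e : Finset (Fin ℓ), e.card = 2 →
      deviationCode F a (ℓ.choose 2 * m) T e = deviationCode F a (ℓ.choose 2 * m) T' e) :
    T = T' := by
  have hdev : ∀ {T : X → Finset (Fin ℓ)}, T ∈ regularPart F a (ℓ.choose 2 * m) →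
      ∀ {x}, T x ≠ {a x} → ∃ b ∈ T x, b ≠ a x ∧ Heavy F a (ℓ.choose 2 * m) x b := by
    intro T hT x hx
    obtain ⟨hTF, hd, hreg⟩ := Finset.mem_filter.1 hT
    obtain ⟨b', hb', hne'⟩ : ∃ b' ∈ T x, b' ≠ a x := by
      by_contra! hcon
      exact hx ((hF T hTF x).subset_singleton_iff.1 fun b' hb' => by simp [hcon b' hb'])
    exact ⟨b', hb', hne', hreg x b' hb' hne'⟩
  have hmem : ∀ {T T' : X → Finset (Fin ℓ)}, T ∈ regularPart F a (ℓ.choose 2 * m) →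
      (∀ e : Finset (Fin ℓ), e.card = 2 →
      deviationCode F a (ℓ.choose 2 * m) T e = deviationCode F a (ℓ.choose 2 * m) T' e) →
      ∀ {x}, T x ≠ {a x} → T' x ≠ {a x} ∧ (a x ∈ T x ↔ a x ∈ T' x) := by
    intro T T' hT hcode x hx
    obtain ⟨b, hb, hba, hheavy⟩ := hdev hT hx
    have h1 := hcode {a x, b} (Finset.card_pair hba.symm)
    have hxP : x ∈ heavyPart F a (ℓ.choose 2 * m) {a x, b} := by
      simp only [heavyPart, Finset.mem_filter, Finset.mem_univ, true_and]
      exact ⟨b, hheavy, rfl⟩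
    simp only [deviationCode, Sigma.mk.injEq, heq_eq_eq, Finset.ext_iff, Finset.mem_filter] at h1
    have h2 := h1.1 x
    have h3 := h1.2 x
    simp only [hxP, true_and] at h2 h3
    have h4 := h2.1 hx
    exact ⟨h4, by tauto⟩
  funext x
  by_cases hx : T x = {a x}
  · by_contra hne
    have hx' : T' x ≠ {a x} := fun h0 => hne (hx.trans h0.symm)
    exact (hmem hT' (fun e he => (hcode e he).symm) hx').1 hx
  · obtain ⟨hx', hiff⟩ := hmem hT hcode hx
    obtain ⟨b, hb, hba, hheavy⟩ := hdev hT hx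
    obtain ⟨b', hb', hba', hheavy'⟩ := hdev hT' hx'
    obtain rfl := h.heavy_unique hF hgen hheavy hheavy'
    ext j
    by_cases hj : j = a x
    · rw [hj]; exact hiff
    · constructor
      · intro hjT
        rw [h.heavy_unique hF hgen ((Finset.mem_filter.1 hT).2.2 x j hjT hj) hheavy]
        exact hb'
      · intro hjT
        rw [h.heavy_unique hF hgen ((Finset.mem_filter.1 hT').2.2 x j hjT hj) hheavy]
        exact hb

lemma CrossBounded.card_regularPart_le (h : CrossBounded m F)
    (hF : ∀ T ∈ F, ∀ x, (T x).Nonempty)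
    (hgen : ∀ Y : Finset X, Y.card ≤ 4 * (ℓ.choose 2 * m) →
      ∃ T ∈ F, hammingDist T (fun x => {a x}) = ℓ.choose 2 * m ∧ ∀ x ∈ Y, T x = {a x}) :
    (regularPart F a (ℓ.choose 2 * m)).card ≤
      ∏ e ∈ Finset.powersetCard 2 (Finset.univ : Finset (Fin ℓ)),
        ((heavyPart F a (ℓ.choose 2 * m) e).card.choose m * 2 ^ m) := by
  let W : Finset (Fin ℓ) → Finset ((_ : Finset X) × Finset X) := fun e =>
    (Finset.powersetCard m (heavyPart F a (ℓ.choose 2 * m) e)).sigma fun A => A.powerset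
  have hW : ∀ e, (W e).card = (heavyPart F a (ℓ.choose 2 * m) e).card.choose m * 2 ^ m := by
    intro e
    rw [Finset.card_sigma, Finset.sum_congr rfl (g := fun _ => 2 ^ m), Finset.sum_const,
      Finset.card_powersetCard, smul_eq_mul]
    intro A hA
    rw [Finset.card_powerset, (Finset.mem_powersetCard.1 hA).2]
  simp only [← hW]
  rw [← Finset.card_pi]
  refine Finset.card_le_card_of_injOn
    (fun T e _ => deviationCode F a (ℓ.choose 2 * m) T e) ?_ ?_
  · intro T hT
    simp only [Finset.mem_coe, Finset.mem_pi]
    intro e he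
    simp only [W, deviationCode, Finset.mem_sigma, Finset.mem_powersetCard, Finset.mem_powerset]
    refine ⟨⟨Finset.filter_subset _ _, ?_⟩, ?_⟩
    · exact h.card_deviation_eq hF hgen hT (Finset.mem_powersetCard.1 he).2
    · intro x hx
      simp only [Finset.mem_filter] at hx ⊢
      exact ⟨hx.1, hx.2.1⟩
  · intro T hT T' hT' heq
    refine h.deviationCode_injOn hF hgen hT hT' fun e he => ?_
    exact congrFun (congrFun heq e) (Finset.mem_powersetCard.2 ⟨Finset.subset_univ _, he⟩)

lemma CrossBounded.sum_card_heavyPart_le (h : CrossBounded m F)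
    (hF : ∀ T ∈ F, ∀ x, (T x).Nonempty)
    (hgen : ∀ Y : Finset X, Y.card ≤ 4 * (ℓ.choose 2 * m) →
      ∃ T ∈ F, hammingDist T (fun x => {a x}) = ℓ.choose 2 * m ∧ ∀ x ∈ Y, T x = {a x}) :
    ∑ e ∈ Finset.powersetCard 2 (Finset.univ : Finset (Fin ℓ)),
      (heavyPart F a (ℓ.choose 2 * m) e).card ≤ Fintype.card X := by
  rw [← Finset.card_biUnion]
  · exact Finset.card_le_univ _
  · intro e _ e' _ hne
    refine Finset.disjoint_left.2 fun x hx hx' => ?_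
    obtain ⟨b, hb, rfl⟩ := (Finset.mem_filter.1 hx).2
    obtain ⟨b', hb', rfl⟩ := (Finset.mem_filter.1 hx').2
    rw [h.heavy_unique hF hgen hb hb'] at hne
    exact hne rfl

end Structure

end Fiber

lemma prod_le_sum_div_card_pow {ι : Type*} (s : Finset ι) (f : ι → ℝ) (hf : ∀ i ∈ s, 0 ≤ f i) :
    ∏ i ∈ s, f i ≤ ((∑ i ∈ s, f i) / s.card) ^ s.card := by
  rcases s.eq_empty_or_nonempty with rfl | hs
  · simp
  have hc : (0 : ℝ) < s.card := by exact_mod_cast hs.card_pos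
  have h1 := Real.geom_mean_le_arith_mean s (fun _ => 1) f (fun _ _ => zero_le_one)
    (by simpa using hs) hf
  simp only [Real.rpow_one, Finset.sum_const, nsmul_eq_mul, mul_one, one_mul] at h1
  have h2 := pow_le_pow_left₀ (Real.rpow_nonneg (Finset.prod_nonneg hf) _) h1 s.card
  rwa [← Real.rpow_natCast, ← Real.rpow_mul (Finset.prod_nonneg hf),
    inv_mul_cancel₀ hc.ne', Real.rpow_one] at h2

lemma prod_choose_mul_le {ι : Type*} (s : Finset ι) (f : ι → ℕ) (m : ℕ) {N : ℕ}
    (hN : ∑ i ∈ s, f i ≤ N) :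
    ((∏ i ∈ s, ((f i).choose m * 2 ^ m) : ℕ) : ℝ) ≤
      ((m.factorial : ℝ)⁻¹ * (2 * (N : ℝ) / (s.card : ℝ)) ^ m) ^ s.card := by
  push_cast
  calc ∏ i ∈ s, (((f i).choose m : ℝ) * 2 ^ m)
      ≤ ∏ i ∈ s, ((m.factorial : ℝ)⁻¹ * 2 ^ m * (f i : ℝ) ^ m) := by
        refine Finset.prod_le_prod (fun _ _ => by positivity) fun i _ => ?_
        have := Nat.choose_le_pow_div (α := ℝ) m (f i)
        calc _ ≤ ((f i : ℝ) ^ m / m.factorial) * 2 ^ m := by gcongr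
          _ = _ := by ring
    _ = ((m.factorial : ℝ)⁻¹ * 2 ^ m) ^ s.card * (∏ i ∈ s, (f i : ℝ)) ^ m := by
        rw [Finset.prod_mul_distrib, Finset.prod_const, Finset.prod_pow]
    _ ≤ ((m.factorial : ℝ)⁻¹ * 2 ^ m) ^ s.card * (((N : ℝ) / s.card) ^ s.card) ^ m := by
        have h1 := prod_le_sum_div_card_pow s (fun i => (f i : ℝ)) (fun _ _ => by positivity)
        have h2 : ∑ i ∈ s, (f i : ℝ) ≤ N := by exact_mod_cast hN
        have h3 : (0 : ℝ) ≤ ∏ i ∈ s, (f i : ℝ) := by positivity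
        gcongr
        refine h1.trans ?_
        gcongr
    _ = _ := by
        rw [← pow_mul, mul_comm s.card m, pow_mul, ← mul_pow, mul_assoc, ← mul_pow,
          mul_div_assoc]

lemma exists_card_le_of_crossBounded (ℓ m : ℕ) (hk : 1 ≤ ℓ.choose 2 * m) :
    ∃ K : ℕ, ∀ (X : Type) [Fintype X] (F : Finset (X → Finset (Fin ℓ))),
      (∀ T ∈ F, ∀ x, (T x).Nonempty) → CrossBounded m F →
      (F.card : ℝ) ≤ ((m.factorial : ℝ)⁻¹ *
          (2 * (Fintype.card X : ℝ) / (ℓ.choose 2 : ℝ)) ^ m) ^ (ℓ.choose 2) +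
        K * ((Fintype.card X : ℝ) + 1) ^ (ℓ.choose 2 * m - 1) := by
  set k := ℓ.choose 2 * m with hkdef
  set q := Fintype.card (Finset (Fin ℓ)) with hq
  refine ⟨2 * (8 * k * q) ^ (2 * k) * q ^ (k - 1) + (1 + ℓ * k * q) * q ^ (k - 1), ?_⟩
  intro X _ F hF h
  set N := Fintype.card X
  set A := 2 * (8 * k * q) ^ (2 * k) * q ^ (k - 1) with hA
  set B := (1 + ℓ * k * q) * q ^ (k - 1) with hB
  clear_value A B
  have hN : (0 : ℝ) ≤ ((N : ℝ) + 1) ^ (k - 1) := by positivity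
  have hmain : (0 : ℝ) ≤ ((m.factorial : ℝ)⁻¹ *
          (2 * (N : ℝ) / (ℓ.choose 2 : ℝ)) ^ m) ^ (ℓ.choose 2) := by positivity
  push_cast
  by_cases hbig : F.card ≤ A * (N + 1) ^ (k - 1)
  · have h1 : (F.card : ℝ) ≤ A * ((N : ℝ) + 1) ^ (k - 1) := by exact_mod_cast hbig
    have h2 : (0 : ℝ) ≤ B * ((N : ℝ) + 1) ^ (k - 1) := by positivity
    linarith
  obtain ⟨c, hc, hle, hgen⟩ := exists_generic_center k hk F
    (fun T hT T' hT' => (hammingDist_le_sum_cross (hF T hT) (hF T' hT')).trans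
      ((sum_cross_eq T T').symm.le.trans (h.sum_le hT hT')))
    (by rw [mul_pow q (N + 1), ← mul_assoc, ← hA]; exact not_le.1 hbig)
  have hsing : ∀ x, ∃ i, c x = {i} := by
    intro x
    obtain ⟨T, hT, hd, hTx⟩ := hgen {x} (by rw [Finset.card_singleton]; omega)
    obtain ⟨T', hT', hd', hTx'⟩ := hgen (insert x (Finset.univ.filter fun y => T y ≠ c y)) (by
      refine (Finset.card_insert_le _ _).trans ?_
      change hammingDist T c + 1 ≤ _
      omega)
    have h1 := hammingDist_add_of_disjoint (c := c) (T := T') (T' := T)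
      (fun y hy => hTx' y (by simp [hy]))
    have h2 : T' x = c x := hTx' x (by simp)
    have h3 : T x = c x := hTx x (by simp)
    obtain ⟨i, hi⟩ := hF T' hT' x
    refine ⟨i, h2 ▸ Finset.eq_singleton_iff_unique_mem.2 ⟨hi, fun j hj => ?_⟩⟩
    exact h.eq_of_hammingDist_eq hF hT' hT (by omega) (h2.trans h3.symm) hj hi
  choose a ha using hsing
  obtain rfl : c = fun x => {a x} := funext ha
  have h1 := card_le_card_regularPart_add hle hk
  have h2 := h.card_regularPart_le hF hgen
  have h3 := h.sum_card_heavyPart_le hF hgen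
  rw [← hkdef] at h2 h3
  set E := Finset.powersetCard 2 (Finset.univ : Finset (Fin ℓ)) with hE
  have hEc : E.card = ℓ.choose 2 := by simp [hE]
  have h4 : ((regularPart F a k).card : ℝ) ≤ ((m.factorial : ℝ)⁻¹ *
          (2 * (N : ℝ) / (ℓ.choose 2 : ℝ)) ^ m) ^ (ℓ.choose 2) := by
    have h4 := prod_choose_mul_le E (fun e => (heavyPart F a k e).card) m h3
    rw [hEc] at h4
    exact (Nat.cast_le.2 h2).trans h4
  have h5 : (F.card : ℝ) ≤ (regularPart F a k).card + B * ((N : ℝ) + 1) ^ (k - 1) := by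
    rw [hB]
    exact_mod_cast h1
  have h6 : (0 : ℝ) ≤ A * ((N : ℝ) + 1) ^ (k - 1) := by positivity
  linarith

lemma sum_choose_mul_pow_le (k : ℕ) : ∀ a n : ℕ,
    ∑ j ∈ Finset.range (n + 1), n.choose j * (2 * j + a) ^ k ≤ 2 ^ n * (n + a + 2 * k) ^ k := by
  induction k with
  | zero => intro a n; simp [Nat.sum_range_choose]
  | succ k ih =>
    intro a n
    have hsplit : ∑ j ∈ Finset.range (n + 1), n.choose j * (2 * j + a) ^ (k + 1) =
        ∑ j ∈ Finset.range (n + 1), n.choose j * (2 * j) * (2 * j + a) ^ k +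
          a * ∑ j ∈ Finset.range (n + 1), n.choose j * (2 * j + a) ^ k := by
      rw [Finset.mul_sum, ← Finset.sum_add_distrib]
      exact Finset.sum_congr rfl fun j _ => by ring
    have hfirst : ∑ j ∈ Finset.range (n + 1), n.choose j * (2 * j) * (2 * j + a) ^ k ≤
        n * 2 ^ n * (n + a + 2 * k + 1) ^ k := by
      cases n with
      | zero => simp
      | succ n =>
        rw [Finset.sum_range_succ']
        have hterm : ∀ j, (n + 1).choose (j + 1) * (2 * (j + 1)) * (2 * (j + 1) + a) ^ k =
            (2 * (n + 1)) * (n.choose j * (2 * j + (a + 2)) ^ k) := by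
          intro j
          have := Nat.add_one_mul_choose_eq n j
          calc _ = 2 * ((n + 1).choose (j + 1) * (j + 1)) * (2 * (j + 1) + a) ^ k := by ring
            _ = _ := by rw [← this]; ring
        simp only [hterm, ← Finset.mul_sum]
        have := Nat.mul_le_mul_left (2 * (n + 1)) (ih (a + 2) n)
        have he : n + (a + 2) + 2 * k = n + 1 + a + 2 * k + 1 := by ring
        rw [he] at this
        have hz : (n + 1).choose 0 * (2 * 0) * (2 * 0 + a) ^ k = 0 := by simp
        rw [hz, add_zero]
        refine this.trans (le_of_eq ?_)
        ring
    have hmono1 : (n + a + 2 * k + 1) ^ k ≤ (n + a + 2 * (k + 1)) ^ k :=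
      Nat.pow_le_pow_left (by omega) k
    have hmono2 : (n + a + 2 * k) ^ k ≤ (n + a + 2 * (k + 1)) ^ k :=
      Nat.pow_le_pow_left (by omega) k
    calc _ ≤ n * 2 ^ n * (n + a + 2 * (k + 1)) ^ k +
          a * (2 ^ n * (n + a + 2 * (k + 1)) ^ k) := by
          rw [hsplit]
          exact add_le_add (hfirst.trans (Nat.mul_le_mul_left _ hmono1))
            (Nat.mul_le_mul_left a ((ih a n).trans (Nat.mul_le_mul_left _ hmono2)))
      _ = 2 ^ n * ((n + a + 2 * (k + 1)) ^ k * (n + a)) := by ring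
      _ ≤ _ := by
          rw [pow_succ]
          exact Nat.mul_le_mul_left _ (Nat.mul_le_mul_left _ (by omega))

lemma exists_one_add_mul_pow_le (b : ℝ) (hb : 0 ≤ b) (k : ℕ) :
    ∃ C : ℝ, 0 ≤ C ∧ ∀ t : ℝ, 0 ≤ t → t ≤ 1 → (1 + b * t) ^ k ≤ 1 + C * t := by
  induction k with
  | zero => exact ⟨0, le_rfl, fun t _ _ => by simp⟩
  | succ k ih =>
    obtain ⟨C, hC, h⟩ := ih
    refine ⟨C + b + C * b, by positivity, fun t h0 h1 => ?_⟩
    have h2 : t * t ≤ t := by nlinarith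
    have h3 : 0 ≤ C * b := by positivity
    calc (1 + b * t) ^ (k + 1) ≤ (1 + C * t) * (1 + b * t) := by
          rw [pow_succ]; gcongr; exact h t h0 h1
      _ ≤ _ := by nlinarith

/-- Fix the union of a tuple: the corresponding tuples form a `CrossBounded` family on it. -/
lemma exists_prod_card_le (ℓ m : ℕ) (hk : 1 ≤ ℓ.choose 2 * m) :
    ∃ K : ℕ, ∀ (n : ℕ) (F : Fin ℓ → Finset (Finset (Fin n))), OverlapU n ℓ m F →
      ((∏ k, (F k).card : ℕ) : ℝ) ≤ ∑ j ∈ Finset.range (n + 1), (n.choose j : ℝ) *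
        (((m.factorial : ℝ)⁻¹ * (2 * (j : ℝ) / (ℓ.choose 2 : ℝ)) ^ m) ^ (ℓ.choose 2) +
          K * ((j : ℝ) + 1) ^ (ℓ.choose 2 * m - 1)) := by
  obtain ⟨K, hK⟩ := exists_card_le_of_crossBounded ℓ m hk
  refine ⟨K, fun n F hF => ?_⟩
  set b : ℕ → ℝ := fun j =>
    ((m.factorial : ℝ)⁻¹ * (2 * (j : ℝ) / (ℓ.choose 2 : ℝ)) ^ m) ^ (ℓ.choose 2) +
          K * ((j : ℝ) + 1) ^ (ℓ.choose 2 * m - 1) with hb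
  let tuples (S : Finset (Fin n)) : Finset (Fin ℓ → Finset (Fin n)) :=
    (Fintype.piFinset F).filter fun T => Finset.univ.biUnion T = S
  have hfib : ∀ S, ((tuples S).card : ℝ) ≤ b S.card := by
    intro S
    let dual (T : Fin ℓ → Finset (Fin n)) : S → Finset (Fin ℓ) :=
      fun x => Finset.univ.filter fun k => x.1 ∈ T k
    have hinj : Set.InjOn dual (tuples S) := by
      intro T hT T' hT' heq
      have hsub := (Finset.mem_filter.1 hT).2
      have hsub' := (Finset.mem_filter.1 hT').2
      funext k
      ext x
      by_cases hx : x ∈ S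
      · have := congrFun heq ⟨x, hx⟩
        simp only [dual, Finset.ext_iff, Finset.mem_filter, Finset.mem_univ, true_and] at this
        exact this k
      · constructor
        · intro h; exact (hx (hsub ▸ Finset.mem_biUnion.2 ⟨k, Finset.mem_univ _, h⟩)).elim
        · intro h; exact (hx (hsub' ▸ Finset.mem_biUnion.2 ⟨k, Finset.mem_univ _, h⟩)).elim
    have h1 := hK S ((tuples S).image dual) (by
      intro U hU x
      obtain ⟨T, hT, rfl⟩ := Finset.mem_image.1 hU
      have hx : x.1 ∈ Finset.univ.biUnion T := (Finset.mem_filter.1 hT).2 ▸ x.2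
      obtain ⟨k, -, hk⟩ := Finset.mem_biUnion.1 hx
      exact ⟨k, by simp [dual, hk]⟩) (by
      intro U hU U' hU' i j hij
      obtain ⟨T, hT, rfl⟩ := Finset.mem_image.1 hU
      obtain ⟨T', hT', rfl⟩ := Finset.mem_image.1 hU'
      have hTi := Fintype.mem_piFinset.1 (Finset.mem_filter.1 hT).1 i
      have hTj := Fintype.mem_piFinset.1 (Finset.mem_filter.1 hT').1 j
      refine le_trans ?_ (hF i j hij _ hTi _ hTj)
      refine Finset.card_le_card_of_injOn Subtype.val ?_ Subtype.val_injective.injOn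
      intro x hx
      simpa [dual] using hx)
    rw [Finset.card_image_of_injOn hinj, Fintype.card_coe] at h1
    exact h1
  have hsum : (∏ k, (F k).card) = ∑ S : Finset (Fin n), (tuples S).card := by
    rw [← Fintype.card_piFinset]
    exact Finset.card_eq_sum_card_fiberwise (f := fun T => Finset.univ.biUnion T)
      (fun _ _ => Finset.mem_coe.2 (Finset.mem_univ _))
  rw [hsum, Nat.cast_sum]
  refine (Finset.sum_le_sum fun S _ => hfib S).trans (le_of_eq ?_)
  have := Finset.sum_powerset_apply_card b (x := (Finset.univ : Finset (Fin n)))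
  rw [Finset.powerset_univ, Finset.card_univ, Fintype.card_fin] at this
  rw [this]
  simp only [nsmul_eq_mul, hb]

lemma sStarU_spec (n ℓ m : ℕ) :
    (∃ F : Fin ℓ → Finset (Finset (Fin n)), OverlapU n ℓ m F ∧
      sStarU n ℓ m = ∏ k, (F k).card) ∧
    ∀ F : Fin ℓ → Finset (Finset (Fin n)), OverlapU n ℓ m F →
      ∏ k, (F k).card ≤ sStarU n ℓ m := by
  have hbdd : BddAbove {P : ℕ | ∃ F : Fin ℓ → Finset (Finset (Fin n)),
      OverlapU n ℓ m F ∧ P = ∏ k, (F k).card} := by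
    refine Set.Finite.bddAbove ((Set.finite_range
      fun F : Fin ℓ → Finset (Finset (Fin n)) => ∏ k, (F k).card).subset ?_)
    rintro P ⟨F, -, rfl⟩
    exact ⟨F, rfl⟩
  have hempty : OverlapU n ℓ m fun _ => ∅ := by
    intro k1 k2 _ A hA
    simp at hA
  refine ⟨?_, fun F hF => le_csSup hbdd ⟨F, hF, rfl⟩⟩
  exact Nat.sSup_mem (s := {P : ℕ | ∃ F : Fin ℓ → Finset (Finset (Fin n)),
    OverlapU n ℓ m F ∧ P = ∏ k, (F k).card}) ⟨_, _, hempty, rfl⟩ hbdd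

lemma exists_balanced_coloring {E : Type*} [Fintype E] [DecidableEq E] [Nonempty E] (n : ℕ) :
    ∃ col : Fin n → E, ∀ e,
      n / Fintype.card E ≤ (Finset.univ.filter fun x => col x = e).card := by
  have hp : 0 < Fintype.card E := Fintype.card_pos
  let φ := Fintype.equivFin E
  refine ⟨fun x => φ.symm ⟨x.1 % Fintype.card E, Nat.mod_lt _ hp⟩, fun e => ?_⟩
  have hlt : ∀ t : Fin (n / Fintype.card E), Fintype.card E * t.1 + (φ e).1 < n := by
    intro t
    have h1 : t.1 + 1 ≤ n / Fintype.card E := t.2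
    have h2 := Nat.mul_le_mul_left (Fintype.card E) h1
    have h3 := Nat.mul_div_le n (Fintype.card E)
    have h4 := (φ e).2
    rw [Nat.mul_add] at h2
    omega
  calc n / Fintype.card E = (Finset.univ : Finset (Fin (n / Fintype.card E))).card := by simp
    _ ≤ _ := by
      refine Finset.card_le_card_of_injOn
        (fun t => (⟨Fintype.card E * t.1 + (φ e).1, hlt t⟩ : Fin n)) ?_ ?_
      · intro t _
        simp [Nat.mod_eq_of_lt (φ e).2]
      · intro t _ t' _ h
        simp only [Fin.mk.injEq, Nat.add_right_cancel_iff] at h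
        exact Fin.ext (Nat.eq_of_mul_eq_mul_left hp h)

lemma prod_card_le_card_filter_inter {α E : Type*} [Fintype α] [DecidableEq α] [Fintype E]
    [DecidableEq E] (col : α → E) (G : E → Finset (Finset α))
    (hG : ∀ e, ∀ A ∈ G e, ∀ x ∈ A, col x = e) :
    ∏ e, (G e).card ≤ (Finset.univ.filter fun A : Finset α =>
      ∀ e, (A.filter fun x => col x = e) ∈ G e).card := by
  rw [← Fintype.card_piFinset]
  have hrec : ∀ g ∈ Fintype.piFinset G, ∀ e,
      ((Finset.univ.biUnion g).filter fun x => col x = e) = g e := by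
    intro g hg e
    ext x
    simp only [Finset.mem_filter, Finset.mem_biUnion, Finset.mem_univ, true_and]
    constructor
    · rintro ⟨⟨e', he'⟩, rfl⟩
      rwa [hG e' _ (Fintype.mem_piFinset.1 hg e') x he']
    · intro hx
      exact ⟨⟨e, hx⟩, hG e _ (Fintype.mem_piFinset.1 hg e) x hx⟩
  refine Finset.card_le_card_of_injOn (fun g => Finset.univ.biUnion g) ?_ ?_
  · intro g hg
    simp only [Finset.coe_filter, Finset.mem_univ, true_and, Set.mem_ofPred_eq]
    intro e
    rw [hrec g hg e]
    exact Fintype.mem_piFinset.1 hg e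
  · intro g hg g' hg' heq
    funext e
    rw [← hrec g hg e, ← hrec g' hg' e]
    simp only at heq
    rw [heq]

/-- Splitting the ground set evenly among the pairs `{i, j}`, letting one of the two families
be everything and the other all `m`-subsets on the part of that pair. -/
lemma choose_pow_mul_le_sStarU (n ℓ m : ℕ) (hℓ : 2 ≤ ℓ) :
    ((n / ℓ.choose 2).choose m) ^ (ℓ.choose 2) * 2 ^ n ≤ sStarU n ℓ m := by
  let E := {e : Finset (Fin ℓ) // e.card = 2}
  have hEc : Fintype.card E = ℓ.choose 2 := by
    rw [Fintype.card_finset_len, Fintype.card_fin]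
  have hE : Nonempty E := by
    rw [← Fintype.card_pos_iff, hEc]
    exact Nat.choose_pos hℓ
  obtain ⟨col, hcol⟩ := exists_balanced_coloring (E := E) n
  rw [hEc] at hcol
  choose i j hij he using fun e : E => Finset.card_eq_two.1 e.2
  let P : E → Finset (Fin n) := fun e => Finset.univ.filter fun x => col x = e
  let G : Fin ℓ → E → Finset (Finset (Fin n)) := fun k e =>
    if k = i e then (P e).powerset else if k = j e then (P e).powersetCard m else {∅}
  let F : Fin ℓ → Finset (Finset (Fin n)) := fun k =>
    Finset.univ.filter fun A => ∀ e, (A.filter fun x => col x = e) ∈ G k e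
  have hG : ∀ k e, ∀ A ∈ G k e, ∀ x ∈ A, col x = e := by
    intro k e A hA x hx
    simp only [G] at hA
    split_ifs at hA with h1 h2
    · simpa [P] using Finset.mem_powerset.1 hA hx
    · simpa [P] using (Finset.mem_powersetCard.1 hA).1 hx
    · simp only [Finset.mem_singleton] at hA
      simp [hA] at hx
  have hF : OverlapU n ℓ m F := by
    intro k1 k2 hk A hA B hB
    let e₀ : E := ⟨{k1, k2}, Finset.card_pair hk⟩
    have hmem : ∀ k, ∀ A ∈ F k, ∀ x ∈ A, k ∈ (col x).1 := by
      intro k A hA x hx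
      have h1 := (Finset.mem_filter.1 hA).2 (col x)
      have hx' : x ∈ A.filter fun y => col y = col x := by simp [hx]
      simp only [G] at h1
      split_ifs at h1 with h2 h3
      · rw [he, h2]; simp
      · rw [he, h3]; simp
      · rw [Finset.mem_singleton.1 h1] at hx'
        simp at hx'
    have hcol₀ : ∀ x ∈ A ∩ B, col x = e₀ := by
      intro x hx
      obtain ⟨hxA, hxB⟩ := Finset.mem_inter.1 hx
      refine Subtype.ext (Finset.eq_of_subset_of_card_le ?_ ?_).symm
      · intro k hk'
        simp only [e₀, Finset.mem_insert, Finset.mem_singleton] at hk'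
        rcases hk' with rfl | rfl
        · exact hmem _ A hA x hxA
        · exact hmem _ B hB x hxB
      · rw [(col x).2, e₀.2]
    have hsmall : ∀ A ∈ F (j e₀), (A.filter fun x => col x = e₀).card ≤ m := by
      intro A hA
      have h1 := (Finset.mem_filter.1 hA).2 e₀
      simp only [G, if_neg (hij e₀).symm, if_true] at h1
      exact (Finset.mem_powersetCard.1 h1).2.le
    have hj : j e₀ = k1 ∨ j e₀ = k2 := by
      have h1 : j e₀ ∈ e₀.1 := by rw [he e₀]; simp
      simpa [e₀] using h1
    rcases hj with hj | hj
    · refine le_trans (Finset.card_le_card fun x hx => ?_) (hsmall A (hj ▸ hA))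
      exact Finset.mem_filter.2 ⟨(Finset.mem_inter.1 hx).1, hcol₀ x hx⟩
    · refine le_trans (Finset.card_le_card fun x hx => ?_) (hsmall B (hj ▸ hB))
      exact Finset.mem_filter.2 ⟨(Finset.mem_inter.1 hx).2, hcol₀ x hx⟩
  refine le_trans ?_ ((sStarU_spec n ℓ m).2 F hF)
  have hPsum : ∑ e, (P e).card = n := by
    rw [← Finset.card_eq_sum_card_fiberwise (f := col)
      (fun _ _ => Finset.mem_coe.2 (Finset.mem_univ _))]
    simp
  have hGprod : ∀ e, ∏ k, (G k e).card = 2 ^ (P e).card * (P e).card.choose m := by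
    intro e
    have h1 : ∀ k, (G k e).card = (if k = i e then 2 ^ (P e).card else 1) *
        (if k = j e then (P e).card.choose m else 1) := by
      intro k
      have := hij e
      simp only [G]
      split_ifs with h2 h3 h3
      · exact absurd (h2.symm.trans h3) this
      · simp
      · simp
      · simp
    simp only [h1, Finset.prod_mul_distrib, Finset.prod_ite_eq', Finset.mem_univ, if_true]
  calc ((n / ℓ.choose 2).choose m) ^ (ℓ.choose 2) * 2 ^ n
      = ∏ e : E, (2 ^ (P e).card * (n / ℓ.choose 2).choose m) := by
        rw [Finset.prod_mul_distrib, Finset.prod_pow_eq_pow_sum, hPsum, Finset.prod_const,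
          Finset.card_univ, hEc, mul_comm]
    _ ≤ ∏ e : E, (2 ^ (P e).card * (P e).card.choose m) := by
        refine Finset.prod_le_prod' fun e _ => Nat.mul_le_mul_left _ ?_
        exact Nat.choose_le_choose m (hcol e)
    _ = ∏ k, ∏ e, (G k e).card := by
        rw [Finset.prod_comm]
        exact Finset.prod_congr rfl fun e _ => (hGprod e).symm
    _ ≤ _ := Finset.prod_le_prod' fun k _ => prod_card_le_card_filter_inter col (G k) (hG k)

lemma sStarU_lower_bound (ℓ m n : ℕ) (hℓ : 2 ≤ ℓ) (hn : 1 ≤ n) :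
    (1 - ((ℓ.choose 2 * m : ℕ) : ℝ) ^ 2 / (n : ℝ)) *
          ((((Nat.factorial m : ℝ))⁻¹ * ((n : ℝ) / (ℓ.choose 2 : ℝ)) ^ m) ^ (ℓ.choose 2)
            * 2 ^ n)
        ≤ (sStarU n ℓ m : ℝ) := by
  set p := ℓ.choose 2 with hp
  have hp0 : 0 < p := Nat.choose_pos hℓ
  have hp0' : (0 : ℝ) < p := by exact_mod_cast hp0
  have hn0 : (0 : ℝ) < n := by exact_mod_cast hn
  by_cases hsmall : n < p * m
  · refine le_trans (mul_nonpos_of_nonpos_of_nonneg ?_ (by positivity)) (Nat.cast_nonneg _)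
    rw [sub_nonpos, le_div_iff₀ hn0, one_mul]
    have : n ≤ (p * m) ^ 2 := by nlinarith
    exact_mod_cast this
  have hlow := choose_pow_mul_le_sStarU n ℓ m hℓ
  have hlow' : (((n / p).choose m : ℕ) : ℝ) ^ p * 2 ^ n ≤ (sStarU n ℓ m : ℝ) := by
    exact_mod_cast hlow
  refine le_trans ?_ hlow'
  rw [← mul_assoc]
  gcongr
  have hnp : (p * m : ℕ) ≤ n := not_lt.1 hsmall
  have hnp' : ((p * m : ℕ) : ℝ) ≤ n := by exact_mod_cast hnp
  have ht : ((p * m : ℕ) : ℝ) / n ≤ 1 := (div_le_one hn0).2 hnp'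
  have hfloor : (n : ℝ) / p - m ≤ ((n / p + 1 - m : ℕ) : ℝ) := by
    have hmle : m ≤ n / p := (Nat.le_div_iff_mul_le hp0).2 (by rwa [mul_comm])
    rw [Nat.cast_sub (by omega)]
    have h1 : n < p * (n / p + 1) := Nat.lt_mul_div_succ n hp0
    have h2 : (n : ℝ) ≤ p * ((n / p + 1 : ℕ) : ℝ) := by exact_mod_cast h1.le
    have h3 : (n : ℝ) / p ≤ ((n / p + 1 : ℕ) : ℝ) := by rwa [div_le_iff₀' hp0']
    linarith
  have hfac : (n : ℝ) / p - m = n / p * (1 - ((p * m : ℕ) : ℝ) / n) := by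
    push_cast; field_simp
  have hchoose : ((m.factorial : ℝ))⁻¹ * ((n : ℝ) / p) ^ m * (1 - ((p * m : ℕ) : ℝ) / n) ^ m ≤
      (((n / p).choose m : ℕ) : ℝ) := by
    have h1 := Nat.pow_le_choose (α := ℝ) m (n / p)
    refine le_trans ?_ h1
    rw [mul_assoc, ← mul_pow, ← hfac, inv_mul_eq_div]
    have h0 : 0 ≤ (n : ℝ) / p - m := by
      rw [hfac]
      exact mul_nonneg (by positivity) (by linarith)
    gcongr
  have hbern : 1 - ((p * m : ℕ) : ℝ) ^ 2 / n ≤ (1 - ((p * m : ℕ) : ℝ) / n) ^ (p * m) := by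
    have h1 := one_add_mul_le_pow (a := -(((p * m : ℕ) : ℝ) / n)) (by linarith) (p * m)
    rw [← sub_eq_add_neg] at h1
    refine le_trans (le_of_eq ?_) h1
    ring
  have ht0 : (0 : ℝ) ≤ 1 - ((p * m : ℕ) : ℝ) / n := by linarith
  calc _ ≤ (1 - ((p * m : ℕ) : ℝ) / n) ^ (p * m) *
        (((m.factorial : ℝ))⁻¹ * ((n : ℝ) / p) ^ m) ^ p := by gcongr
    _ = (((m.factorial : ℝ))⁻¹ * ((n : ℝ) / p) ^ m * (1 - ((p * m : ℕ) : ℝ) / n) ^ m) ^ p := by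
        rw [mul_pow _ (_ ^ m) p, ← pow_mul, mul_comm p m]; ring
    _ ≤ _ := by gcongr

lemma exists_sStarU_upper_bound (ℓ m : ℕ) (hℓ : 2 ≤ ℓ) (hm : 1 ≤ m) :
    ∃ C : ℝ, 0 ≤ C ∧ ∀ n : ℕ, 1 ≤ n → (sStarU n ℓ m : ℝ) ≤
        (1 + C / (n : ℝ)) *
          ((((Nat.factorial m : ℝ))⁻¹ * ((n : ℝ) / (ℓ.choose 2 : ℝ)) ^ m) ^ (ℓ.choose 2)
            * 2 ^ n) := by
  have hp0 : 0 < ℓ.choose 2 := Nat.choose_pos hℓ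
  have hk : 1 ≤ ℓ.choose 2 * m := Nat.mul_pos hp0 hm
  obtain ⟨K, hK⟩ := exists_prod_card_le ℓ m hk
  set p := ℓ.choose 2 with hp
  have hp0' : (0 : ℝ) < p := by exact_mod_cast hp0
  set k := p * m with hkdef
  set c₀ : ℝ := ((m.factorial : ℝ)⁻¹ * ((p : ℝ)⁻¹) ^ m) ^ p with hc₀
  have hc₀pos : 0 < c₀ := by positivity
  have hform : ∀ y : ℝ, ((m.factorial : ℝ)⁻¹ * (y / p) ^ m) ^ p = c₀ * y ^ k := by
    intro y
    rw [hc₀, hkdef, mul_comm p m, pow_mul, ← mul_pow, mul_assoc, ← mul_pow, div_eq_inv_mul]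
  obtain ⟨C₁, hC₁, hpow⟩ := exists_one_add_mul_pow_le (2 * k) (by positivity) k
  refine ⟨C₁ + K * 2 ^ (k - 1) / c₀, by positivity, fun n hn => ?_⟩
  have hn0 : (0 : ℝ) < n := by exact_mod_cast hn
  have hn1 : (1 : ℝ) ≤ n := by exact_mod_cast hn
  obtain ⟨F, hF, hs⟩ := (sStarU_spec n ℓ m).1
  rw [hs, hform]
  refine (hK n F hF).trans ?_
  simp only [hform, mul_add, Finset.sum_add_distrib]
  have hmoment : ∑ j ∈ Finset.range (n + 1), (n.choose j : ℝ) * (c₀ * (2 * (j : ℝ)) ^ k) ≤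
      c₀ * (2 ^ n * ((n : ℝ) + 2 * k) ^ k) := by
    have h1 : ∑ j ∈ Finset.range (n + 1), (n.choose j : ℝ) * (2 * (j : ℝ)) ^ k ≤
        2 ^ n * ((n : ℝ) + 2 * k) ^ k := by
      have := sum_choose_mul_pow_le k 0 n
      simp only [add_zero] at this
      exact_mod_cast this
    rw [Finset.sum_congr rfl fun j _ => mul_left_comm _ c₀ _, ← Finset.mul_sum]
    gcongr
  have hrest : ∑ j ∈ Finset.range (n + 1), (n.choose j : ℝ) * (K * ((j : ℝ) + 1) ^ (k - 1)) ≤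
      2 ^ n * (K * ((n : ℝ) + 1) ^ (k - 1)) := by
    have h1 : ∑ j ∈ Finset.range (n + 1), (n.choose j : ℝ) = 2 ^ n := by
      exact_mod_cast Nat.sum_range_choose n
    rw [← h1, Finset.sum_mul]
    refine Finset.sum_le_sum fun j hj => ?_
    have : (j : ℝ) ≤ n := by exact_mod_cast Nat.lt_succ_iff.1 (Finset.mem_range.1 hj)
    gcongr
  have hmain : ((n : ℝ) + 2 * k) ^ k ≤ n ^ k * (1 + C₁ / n) := by
    have h1 := hpow (1 / n) (by positivity) ((div_le_one hn0).2 hn1)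
    have h2 : (n : ℝ) + 2 * k = n * (1 + 2 * k * (1 / n)) := by field_simp
    rw [h2, mul_pow, div_eq_mul_one_div C₁]
    gcongr
  have hlower : ((n : ℝ) + 1) ^ (k - 1) ≤ 2 ^ (k - 1) * (n ^ k / n) := by
    have h1 : (n : ℝ) ^ k / n = n ^ (k - 1) := by
      rw [div_eq_iff hn0.ne', ← pow_succ, Nat.sub_add_cancel hk]
    rw [h1, ← mul_pow]
    gcongr
    linarith
  calc _ ≤ c₀ * (2 ^ n * (n ^ k * (1 + C₁ / n))) +
        2 ^ n * (K * (2 ^ (k - 1) * (n ^ k / n))) := by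
        refine add_le_add (hmoment.trans ?_) (hrest.trans ?_) <;> gcongr
    _ = _ := by field_simp; ring

/-- For fixed `ℓ ≥ 2` and `m ≥ 1`, with
`Q(n) = [(1/m!)·(n/C(ℓ,2))^m]^{C(ℓ,2)} · 2^n`, there is a constant `C > 0` such that
`(1 − C/n)·Q(n) ≤ s*(n,ℓ,m) ≤ (1 + C/n)·Q(n)` for all `n ≥ 1`. -/
theorem sStar_uniform_asymptotics (ℓ m : ℕ) (hℓ : 2 ≤ ℓ) (hm : 1 ≤ m) :
    ∃ C : ℝ, 0 < C ∧ ∀ n : ℕ, 1 ≤ n →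
      (1 - C / (n : ℝ)) *
          ((((Nat.factorial m : ℝ))⁻¹ * ((n : ℝ) / (ℓ.choose 2 : ℝ)) ^ m) ^ (ℓ.choose 2)
            * 2 ^ n)
        ≤ (sStarU n ℓ m : ℝ) ∧
      (sStarU n ℓ m : ℝ) ≤
        (1 + C / (n : ℝ)) *
          ((((Nat.factorial m : ℝ))⁻¹ * ((n : ℝ) / (ℓ.choose 2 : ℝ)) ^ m) ^ (ℓ.choose 2)
            * 2 ^ n) := by
  obtain ⟨C, hC, hupper⟩ := exists_sStarU_upper_bound ℓ m hℓ hm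
  refine ⟨C + ((ℓ.choose 2 * m : ℕ) : ℝ) ^ 2 + 1, by positivity, fun n hn => ⟨?_, ?_⟩⟩
  · refine le_trans ?_ (sStarU_lower_bound ℓ m n hℓ hn)
    gcongr
    linarith
  · refine (hupper n hn).trans ?_
    gcongr
    nlinarith [sq_nonneg ((ℓ.choose 2 * m : ℕ) : ℝ)]

end
end

section
/- Fix an integer ℓ ≥ 2 and a vector 𝐦 = (𝐦_S) of nonnegative integers indexed by unordered pairs of distinct elements of [ℓ]. There exist a constant C > 0 and an integer N such that for every n ≥ N and every extremal 𝐦-overlapping tuple 𝓕_1,…,𝓕_ℓ of families of subsets of [n], defining the probabilistic centers C*_k = {x ∈ [n] : d_k(x) ≥ 1/2 − C/n}, the following hold: (i) C*_k ∈ 𝓕_k for every k ∈ [ℓ]; (ii) the sets C*_1,…,C*_ℓ are pairwise disjoint; (iii) C*_1 ∪ … ∪ C*_ℓ = [n]. -/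
open scoped Classical

noncomputable section

/-- The `𝐦`-overlapping property. -/
def Overlap {n ℓ : ℕ} (m : Fin ℓ → Fin ℓ → ℕ) (F : Fin ℓ → Finset (Finset (Fin n))) : Prop :=
  ∀ k1 k2 : Fin ℓ, k1 ≠ k2 → ∀ A ∈ F k1, ∀ B ∈ F k2, (A ∩ B).card ≤ m k1 k2

/-- An `𝐦`-overlapping tuple maximizing the product of cardinalities. -/
def Extremal {n ℓ : ℕ} (m : Fin ℓ → Fin ℓ → ℕ) (F : Fin ℓ → Finset (Finset (Fin n))) : Prop :=
  Overlap m F ∧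
    ∀ G : Fin ℓ → Finset (Finset (Fin n)), Overlap m G →
      ∏ k, (G k).card ≤ ∏ k, (F k).card

/-- The normalized degree `d_k(S) = |{F ∈ 𝓕_k : S ⊆ F}| / |𝓕_k|`. -/
def deg {n ℓ : ℕ} (F : Fin ℓ → Finset (Finset (Fin n))) (k : Fin ℓ) (S : Finset (Fin n)) : ℝ :=
  (((F k).filter (fun A => S ⊆ A)).card : ℝ) / ((F k).card : ℝ)

/-- The set `{x ∈ [n] : d_k(x) ≥ 1/2 − α}` (a probabilistic center). -/
def center {n ℓ : ℕ} (F : Fin ℓ → Finset (Finset (Fin n))) (α : ℝ) (k : Fin ℓ) :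
    Finset (Fin n) :=
  Finset.univ.filter (fun x => (1 : ℝ) / 2 - α ≤ deg F k {x})

section Analytic

variable {ι : Type*} [DecidableEq ι]

lemma one_sub_sum_le_prod_one_sub (s : Finset ι) (d : ι → ℝ) (h0 : ∀ k, 0 ≤ d k)
    (h1 : ∀ k, d k ≤ 1) : 1 - ∑ k ∈ s, d k ≤ ∏ k ∈ s, (1 - d k) := by
  induction s using Finset.induction_on with
  | empty => simp
  | insert x s hx ih =>
    rw [Finset.sum_insert hx, Finset.prod_insert hx]
    have hs : 0 ≤ ∑ k ∈ s, d k := Finset.sum_nonneg fun k _ => h0 k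
    nlinarith [mul_le_mul_of_nonneg_left ih (sub_nonneg.2 (h1 x)), mul_nonneg (h0 x) hs]

lemma prod_one_add_le (s : Finset ι) (r : ι → ℝ) (q : ℝ) (hq : 0 ≤ q) (h0 : ∀ k, 0 ≤ r k)
    (h1 : ∀ k, r k ≤ 1) (hr : ∀ i j, i ≠ j → r i * r j ≤ q) :
    ∏ k ∈ s, (1 + r k) ≤ 1 + ∑ k ∈ s, r k + 4 ^ s.card * q := by
  induction s using Finset.induction_on with
  | empty => simpa using hq
  | insert x s hx ih =>
    rw [Finset.sum_insert hx, Finset.prod_insert hx, Finset.card_insert_of_notMem hx]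
    have hs : r x * ∑ k ∈ s, r k ≤ s.card * q := by
      rw [Finset.mul_sum, ← nsmul_eq_mul]
      exact Finset.sum_le_card_nsmul _ _ _ fun k hk => hr x k (by rintro rfl; exact hx hk)
    have hcard : (s.card : ℝ) ≤ 4 ^ s.card := by
      exact_mod_cast (Nat.lt_pow_self (by norm_num : 1 < 4)).le
    have hmul := mul_le_mul_of_nonneg_left ih (by linarith [h0 x] : 0 ≤ 1 + r x)
    have hp : 0 ≤ (4 : ℝ) ^ s.card * q := by positivity
    have hx1 := mul_le_mul_of_nonneg_right (h1 x) hp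
    have hcq := mul_le_mul_of_nonneg_right hcard hq
    rw [pow_succ]
    nlinarith

variable [Fintype ι]

lemma exists_sum_le_add (r : ι → ℝ) (q c : ℝ) (hc : 0 < c) (h0 : ∀ k, 0 ≤ r k) (hq : 0 ≤ q)
    (hr : ∀ i j, i ≠ j → r i * r j ≤ q) (hsum : c ≤ ∑ k, r k) :
    ∃ i, ∑ k, r k ≤ r i + (Fintype.card ι : ℝ) ^ 2 * q / c := by
  have hne : Nonempty ι := by
    by_contra h
    rw [not_nonempty_iff] at h
    simp at hsum
    linarith
  have hℓ : (0 : ℝ) < Fintype.card ι := by exact_mod_cast Fintype.card_pos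
  obtain ⟨i, -, hi⟩ := Finset.exists_le_of_sum_le (s := Finset.univ)
    (f := fun _ => c / Fintype.card ι) (g := r) Finset.univ_nonempty (by
      simpa [Finset.sum_const, nsmul_eq_mul, mul_div_cancel₀ _ hℓ.ne'] using hsum)
  refine ⟨i, ?_⟩
  rw [← Finset.add_sum_erase _ r (Finset.mem_univ i)]
  have hrest : r i * ∑ k ∈ Finset.univ.erase i, r k ≤ Fintype.card ι * q := by
    rw [Finset.mul_sum]
    calc _ ≤ ((Finset.univ.erase i).card : ℕ) • q :=
          Finset.sum_le_card_nsmul _ _ _ fun k hk => hr i k (Finset.ne_of_mem_erase hk).symm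
      _ ≤ Fintype.card ι * q := by
          rw [nsmul_eq_mul]
          gcongr
          exact Finset.card_le_univ _
  have hs : 0 ≤ ∑ k ∈ Finset.univ.erase i, r k := Finset.sum_nonneg fun k _ => h0 k
  have h2 := (mul_le_mul_of_nonneg_right hi hs).trans hrest
  rw [div_mul_eq_mul_div, div_le_iff₀ hℓ] at h2
  gcongr
  rw [le_div_iff₀ hc]
  linarith

lemma prod_ite_pair (a b : ι → ℝ) (ha : ∀ k, 0 < a k) {i j : ι} (hij : i ≠ j) :
    ∏ k, (if k = i ∨ k = j then b k else a k) = (∏ k, a k) * (b i / a i * (b j / a j)) := by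
  have key : ∀ k, (if k = i ∨ k = j then b k else a k) =
      a k * ((if k = i then b k / a k else 1) * (if k = j then b k / a k else 1)) := by
    intro k
    have := (ha k).ne'
    by_cases h1 : k = i
    · have h2 : k ≠ j := by rintro rfl; exact hij h1.symm
      simp [h1, hij]
      field_simp [h1 ▸ this]
    · by_cases h2 : k = j
      · simp [h2, hij.symm]
        field_simp [h2 ▸ this]
      · simp [h1, h2]
  simp_rw [key, Finset.prod_mul_distrib]
  simp

lemma prod_add_le (a b : ι → ℝ) (Q : ℝ) (hQ : 0 ≤ Q) (hb : ∀ k, 0 ≤ b k) (hba : ∀ k, b k ≤ a k)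
    (h : ∀ i j, i ≠ j → ∏ k, (if k = i ∨ k = j then b k else a k) ≤ Q) :
    ∏ k, (a k + b k) ≤
      2 * ∏ k, a k + (4 ^ Fintype.card ι + (Fintype.card ι : ℝ) ^ 2) * Q := by
  by_cases h0 : ∃ k, a k = 0
  · obtain ⟨k, hk⟩ := h0
    have hbk : b k = 0 := le_antisymm (hk ▸ hba k) (hb k)
    rw [Finset.prod_eq_zero (Finset.mem_univ k) (by simp [hk, hbk]),
      Finset.prod_eq_zero (Finset.mem_univ k) hk]
    positivity
  push Not at h0
  have ha : ∀ k, 0 < a k := fun k => lt_of_le_of_ne ((hb k).trans (hba k)) (h0 k).symm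
  set P := ∏ k, a k with hP
  have hPpos : 0 < P := Finset.prod_pos fun k _ => ha k
  have hr0 : ∀ k, 0 ≤ b k / a k := fun k => div_nonneg (hb k) (ha k).le
  have hr1 : ∀ k, b k / a k ≤ 1 := fun k => (div_le_one (ha k)).2 (hba k)
  have hq : 0 ≤ Q / P := by positivity
  have hr : ∀ i j, i ≠ j → b i / a i * (b j / a j) ≤ Q / P := by
    intro i j hij
    rw [le_div_iff₀ hPpos, mul_comm, ← prod_ite_pair a b ha hij]
    exact h i j hij
  have hprod : ∏ k, (a k + b k) = P * ∏ k, (1 + b k / a k) := by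
    rw [hP, ← Finset.prod_mul_distrib]
    refine Finset.prod_congr rfl fun k _ => ?_
    have := (ha k).ne'
    field_simp
  have hsum : ∑ k, b k / a k ≤ 1 + (Fintype.card ι : ℝ) ^ 2 * (Q / P) := by
    rcases le_total (∑ k, b k / a k) 1 with h1 | h1
    · exact h1.trans (by linarith [mul_nonneg (sq_nonneg (Fintype.card ι : ℝ)) hq])
    · obtain ⟨i, hi⟩ := exists_sum_le_add _ _ 1 one_pos hr0 hq hr h1
      rw [div_one] at hi
      linarith [hr1 i]
  have hfin := prod_one_add_le Finset.univ _ _ hq hr0 hr1 hr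
  rw [Finset.card_univ] at hfin
  rw [hprod]
  calc P * ∏ k, (1 + b k / a k)
      ≤ P * (2 + (4 ^ Fintype.card ι + (Fintype.card ι : ℝ) ^ 2) * (Q / P)) := by
        gcongr; linarith
    _ = _ := by field_simp

end Analytic

lemma prod_card_le_one {ι α : Type*} [Fintype ι] {F : ι → Finset (Finset α)} (hF : ∀ k, ∀ A ∈ F k, A ⊆ ∅) :
    ∏ k, ((F k).card : ℝ) ≤ 1 := by
  refine Finset.prod_le_one (fun _ _ => Nat.cast_nonneg _) fun k _ => ?_
  have : F k ⊆ {∅} := fun A hA => by simpa using hF k A hA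
  exact_mod_cast Finset.card_le_card this

section Overlapping

variable {ι : Type*} [DecidableEq ι] {α : Type*} [DecidableEq α]

/-- The overlapping property with the bounds indexed by unordered pairs. -/
def SymOverlap (m : Sym2 ι → ℕ) (F : ι → Finset (Finset α)) : Prop :=
  ∀ i j : ι, i ≠ j → ∀ A ∈ F i, ∀ B ∈ F j, (A ∩ B).card ≤ m s(i, j)

/-- Lower the overlap bound of a single pair by one. -/
def lowerAt (m : Sym2 ι → ℕ) (S : Sym2 ι) : Sym2 ι → ℕ :=
  Function.update m S (m S - 1)

lemma SymOverlap.link {m : Sym2 ι → ℕ} {F G H : ι → Finset (Finset α)} (hF : SymOverlap m F)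
    {x : α} (hG : ∀ k, ∀ A ∈ G k, ∃ A' ∈ F k, A ⊆ A')
    (hH : ∀ k, ∀ A ∈ H k, insert x A ∈ F k ∧ x ∉ A) (i j : ι) :
    SymOverlap (lowerAt m s(i, j)) (fun k => if k = i ∨ k = j then H k else G k) := by
  have hsub : ∀ k, ∀ A ∈ (if k = i ∨ k = j then H k else G k), ∃ A' ∈ F k, A ⊆ A' := by
    intro k A hA
    split_ifs at hA
    · exact ⟨_, (hH k A hA).1, Finset.subset_insert _ _⟩
    · exact hG k A hA
  intro k l hkl A hA B hB
  by_cases hS : s(k, l) = s(i, j)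
  · have hk : k = i ∨ k = j := by
      rcases Sym2.eq_iff.1 hS with h | h <;> simp [h.1]
    have hl : l = i ∨ l = j := by
      rcases Sym2.eq_iff.1 hS with h | h <;> simp [h.2]
    simp only [hk, hl, if_true] at hA hB
    obtain ⟨hA, hxA⟩ := hH k A hA
    obtain ⟨hB, hxB⟩ := hH l B hB
    have h := hF k l hkl _ hA _ hB
    rw [← Finset.insert_inter_distrib, Finset.card_insert_of_notMem (by simp [hxA]), hS] at h
    rw [lowerAt, hS, Function.update_self]
    omega
  · rw [lowerAt, Function.update_of_ne hS]
    obtain ⟨A', hA', hAA'⟩ := hsub k A hA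
    obtain ⟨B', hB', hBB'⟩ := hsub l B hB
    exact (Finset.card_le_card (Finset.inter_subset_inter hAA' hBB')).trans (hF k l hkl _ hA' _ hB')

lemma SymOverlap.sups {m : Sym2 ι → ℕ} {i j : ι} (hm : 1 ≤ m s(i, j)) {V T : Finset α}
    (hVT : Disjoint V T) {F E : ι → Finset (Finset α)} (hFV : ∀ k, ∀ A ∈ F k, A ⊆ V)
    (hET : ∀ k, ∀ A ∈ E k, A ⊆ T) (hF : SymOverlap (lowerAt m s(i, j)) F)
    (hE : SymOverlap (Function.update 0 s(i, j) 1) E) :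
    SymOverlap m (fun k => Finset.image₂ (· ∪ ·) (F k) (E k)) := by
  intro k l hkl A hA B hB
  obtain ⟨A₁, hA₁, A₂, hA₂, rfl⟩ := Finset.mem_image₂.1 hA
  obtain ⟨B₁, hB₁, B₂, hB₂, rfl⟩ := Finset.mem_image₂.1 hB
  have hAV := hFV k A₁ hA₁
  have hBV := hFV l B₁ hB₁
  have hAT := hET k A₂ hA₂
  have hBT := hET l B₂ hB₂
  have hsub : (A₁ ∪ A₂) ∩ (B₁ ∪ B₂) ⊆ (A₁ ∩ B₁) ∪ (A₂ ∩ B₂) := by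
    intro x hx
    have : x ∈ V → x ∉ T := fun h => Finset.disjoint_left.1 hVT h
    simp only [Finset.mem_inter, Finset.mem_union] at hx ⊢
    have := @hAV x
    have := @hBV x
    have := @hAT x
    have := @hBT x
    tauto
  have h1 := hF k l hkl _ hA₁ _ hB₁
  have h2 := hE k l hkl _ hA₂ _ hB₂
  refine (Finset.card_le_card hsub).trans ((Finset.card_union_le _ _).trans ?_)
  by_cases hS : s(k, l) = s(i, j)
  · rw [lowerAt, hS, Function.update_self] at h1
    rw [hS, Function.update_self] at h2
    rw [hS]
    omega
  · rw [lowerAt, Function.update_of_ne hS] at h1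
    rw [Function.update_of_ne hS] at h2
    simp only [Pi.zero_apply] at h2
    omega

variable [Fintype ι]

/-- The sum of the overlap bounds over all pairs of distinct indices. -/
def pairWeight (m : Sym2 ι → ℕ) : ℕ :=
  ∑ S ∈ Finset.univ.filter (fun S : Sym2 ι => ¬ S.IsDiag), m S

lemma pairWeight_lowerAt (m : Sym2 ι → ℕ) {i j : ι} (hij : i ≠ j) (hm : 1 ≤ m s(i, j)) :
    pairWeight (lowerAt m s(i, j)) + 1 = pairWeight m := by
  have hmem : s(i, j) ∈ Finset.univ.filter (fun S : Sym2 ι => ¬ S.IsDiag) := by simpa using hij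
  unfold pairWeight lowerAt
  rw [Finset.sum_update_of_mem hmem, ← Finset.add_sum_erase _ _ hmem, Finset.sdiff_singleton_eq_erase]
  omega

lemma le_pairWeight (m : Sym2 ι → ℕ) {i j : ι} (hij : i ≠ j) : m s(i, j) ≤ pairWeight m :=
  Finset.single_le_sum (f := m) (fun _ _ => Nat.zero_le _) (by simpa using hij)

lemma SymOverlap.prod_link_le {m : Sym2 ι → ℕ} {F G H : ι → Finset (Finset α)}
    (hF : SymOverlap m F) {x : α} (hG : ∀ k, ∀ A ∈ G k, ∃ A' ∈ F k, A ⊆ A')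
    (hH : ∀ k, ∀ A ∈ H k, insert x A ∈ F k ∧ x ∉ A) {i j : ι} (hij : i ≠ j) (Q : ℝ) (hQ : 0 ≤ Q)
    (hb : 1 ≤ m s(i, j) →
      SymOverlap (lowerAt m s(i, j)) (fun k => if k = i ∨ k = j then H k else G k) →
      ∏ k, (((if k = i ∨ k = j then H k else G k).card : ℕ) : ℝ) ≤ Q) :
    ∏ k, (if k = i ∨ k = j then ((H k).card : ℝ) else ((G k).card : ℝ)) ≤ Q := by
  have hcongr : ∏ k, (if k = i ∨ k = j then ((H k).card : ℝ) else ((G k).card : ℝ)) =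
      ∏ k, (((if k = i ∨ k = j then H k else G k).card : ℕ) : ℝ) :=
    Finset.prod_congr rfl fun k _ => by split_ifs <;> rfl
  by_cases hm : 1 ≤ m s(i, j)
  · rw [hcongr]
    exact hb hm (hF.link hG hH i j)
  · have hempty : H i = ∅ ∨ H j = ∅ := by
      by_contra! h
      obtain ⟨⟨A, hA⟩, ⟨B, hB⟩⟩ := h
      have h := hF i j hij _ (hH i A hA).1 _ (hH j B hB).1
      rw [← Finset.insert_inter_distrib, Finset.card_insert_of_notMem
        (by simp [(hH i A hA).2])] at h
      omega
    rcases hempty with h | h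
    · rwa [Finset.prod_eq_zero (Finset.mem_univ i) (by simp [h])]
    · rwa [Finset.prod_eq_zero (Finset.mem_univ j) (by simp [h])]

lemma pow_succ_add_pow_le (n W : ℕ) :
    ((n : ℝ) + 1) ^ (W + 1) + ((n : ℝ) + 1) ^ W ≤ ((n : ℝ) + 2) ^ (W + 1) := by
  have h : ((n : ℝ) + 1) ^ W ≤ ((n : ℝ) + 2) ^ W := by gcongr; norm_num
  rw [pow_succ, pow_succ]
  have : (0 : ℝ) ≤ n := Nat.cast_nonneg n
  nlinarith

/-- One induction step on the ground set for the upper bound on the product of sizes. -/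
lemma SymOverlap.prod_card_insert_le {m : Sym2 ι → ℕ} {x : α} {U : Finset α}
    {F : ι → Finset (Finset α)} (hFU : ∀ k, ∀ A ∈ F k, A ⊆ insert x U) (hF : SymOverlap m F)
    {P Q : ℝ} (hQ : 0 ≤ Q)
    (hP : ∀ G : ι → Finset (Finset α), (∀ k, ∀ A ∈ G k, A ⊆ U) → SymOverlap m G →
      ∏ k, ((G k).card : ℝ) ≤ P)
    (hlow : ∀ i j, i ≠ j → 1 ≤ m s(i, j) → ∀ G : ι → Finset (Finset α),
      (∀ k, ∀ A ∈ G k, A ⊆ U) → SymOverlap (lowerAt m s(i, j)) G → ∏ k, ((G k).card : ℝ) ≤ Q) :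
    ∏ k, ((F k).card : ℝ) ≤
      2 * P + (4 ^ Fintype.card ι + (Fintype.card ι : ℝ) ^ 2) * Q := by
  set G : ι → Finset (Finset α) :=
    fun k => (F k).memberSubfamily x ∪ (F k).nonMemberSubfamily x with hGdef
  set H : ι → Finset (Finset α) :=
    fun k => (F k).memberSubfamily x ∩ (F k).nonMemberSubfamily x with hHdef
  have hcard : ∀ k, ((F k).card : ℝ) = (G k).card + (H k).card := by
    intro k
    have h1 := Finset.card_union_add_card_inter ((F k).memberSubfamily x)
      ((F k).nonMemberSubfamily x)
    rw [Finset.card_memberSubfamily_add_card_nonMemberSubfamily] at h1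
    exact_mod_cast h1.symm
  have hG : ∀ k, ∀ A ∈ G k, ∃ A' ∈ F k, A ⊆ A' := by
    intro k A hA
    simp only [hGdef, Finset.mem_union, Finset.mem_memberSubfamily,
      Finset.mem_nonMemberSubfamily] at hA
    rcases hA with h | h
    · exact ⟨_, h.1, Finset.subset_insert _ _⟩
    · exact ⟨_, h.1, subset_rfl⟩
  have hGU : ∀ k, ∀ A ∈ G k, A ⊆ U := by
    intro k A hA
    obtain ⟨A', hA', hAA'⟩ := hG k A hA
    have hxA : x ∉ A := by
      simp only [hGdef, Finset.mem_union, Finset.mem_memberSubfamily,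
        Finset.mem_nonMemberSubfamily] at hA
      tauto
    exact (Finset.subset_insert_iff_of_notMem hxA).1 (hAA'.trans (hFU k A' hA'))
  have hHG : ∀ k, H k ⊆ G k := fun k => Finset.inter_subset_union
  have hH : ∀ k, ∀ A ∈ H k, insert x A ∈ F k ∧ x ∉ A := by
    intro k A hA
    exact Finset.mem_memberSubfamily.1 (Finset.mem_inter.1 hA).1
  have hGO : SymOverlap m G := by
    intro k l hkl A hA B hB
    obtain ⟨A', hA', hAA'⟩ := hG k A hA
    obtain ⟨B', hB', hBB'⟩ := hG l B hB
    exact (Finset.card_le_card (Finset.inter_subset_inter hAA' hBB')).trans (hF k l hkl _ hA' _ hB')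
  simp_rw [hcard]
  refine (prod_add_le _ _ Q hQ (fun _ => Nat.cast_nonneg _)
    (fun k => by exact_mod_cast Finset.card_le_card (hHG k)) fun i j hij =>
      hF.prod_link_le hG hH hij Q hQ fun hm hO => hlow i j hij hm _ ?_ hO).trans ?_
  · intro k A hA
    split_ifs at hA
    · exact hGU k A (hHG k hA)
    · exact hGU k A hA
  · linarith [hP G hGU hGO]

/-- The product of sizes of overlapping families is at most `K 2 ^ n (n + 1) ^ W`, where `W` is the
total of the overlap bounds. -/
theorem exists_prod_card_le_s9 (ι : Type*) [Fintype ι] [DecidableEq ι] (W : ℕ) :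
    ∃ K : ℝ, 0 < K ∧ ∀ m : Sym2 ι → ℕ, pairWeight m = W →
      ∀ (n : ℕ) (U : Finset (Fin n)) (F : ι → Finset (Finset (Fin n))),
        (∀ k, ∀ A ∈ F k, A ⊆ U) → SymOverlap m F →
          ∏ k, ((F k).card : ℝ) ≤ K * ((U.card : ℝ) + 1) ^ W * 2 ^ U.card := by
  set D : ℝ := 4 ^ Fintype.card ι + (Fintype.card ι : ℝ) ^ 2 with hD
  have hD0 : 0 ≤ D := by positivity
  induction W with
  | zero =>
    refine ⟨1, one_pos, fun m hm n U => ?_⟩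
    induction U using Finset.induction_on with
    | empty => intro F hFU _; simpa using prod_card_le_one hFU
    | insert x U hx ih =>
      intro F hFU hF
      have h := hF.prod_card_insert_le hFU le_rfl ih fun i j hij hm1 => by
        have := le_pairWeight m hij
        omega
      rw [Finset.card_insert_of_notMem hx, pow_succ]
      refine h.trans (le_of_eq ?_)
      simp
      ring
  | succ W ihW =>
    obtain ⟨K, hK, hKb⟩ := ihW
    refine ⟨1 + D * K, by positivity, fun m hm n U => ?_⟩
    induction U using Finset.induction_on with
    | empty =>
      intro F hFU _
      refine (prod_card_le_one hFU).trans ?_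
      have := mul_nonneg hD0 hK.le
      simpa using this
    | insert x U hx ih =>
      intro F hFU hF
      have h := hF.prod_card_insert_le hFU
        (Q := K * ((U.card : ℝ) + 1) ^ W * 2 ^ U.card) (by positivity) ih
        fun i j hij hm1 G hGU hG => hKb _ (by
          have := pairWeight_lowerAt m hij hm1
          omega) n U G hGU hG
      rw [Finset.card_insert_of_notMem hx, pow_succ (2 : ℝ)]
      refine h.trans ?_
      have hpow := pow_succ_add_pow_le U.card W
      have h1 := mul_le_mul_of_nonneg_left hpow
        (by positivity : 0 ≤ (1 + D * K) * 2 ^ U.card * 2)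
      have h2 : (0 : ℝ) ≤ ((U.card : ℝ) + 1) ^ W * 2 ^ U.card * (2 + D * K) := by positivity
      push_cast
      rw [show ((U.card : ℝ) + 1 + 1) = U.card + 2 by ring]
      nlinarith

lemma card_image₂_union {V T : Finset α} (hVT : Disjoint V T) {F E : Finset (Finset α)}
    (hFV : ∀ A ∈ F, A ⊆ V) (hET : ∀ A ∈ E, A ⊆ T) :
    (Finset.image₂ (· ∪ ·) F E).card = F.card * E.card := by
  refine Finset.card_image₂_iff.2 ?_
  rintro ⟨A₁, A₂⟩ hA ⟨B₁, B₂⟩ hB h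
  simp only [Set.mem_prod, Finset.mem_coe] at hA hB
  have h : A₁ ∪ A₂ = B₁ ∪ B₂ := h
  have hcut : ∀ A B : Finset α, A ⊆ V → B ⊆ T → (A ∪ B) ∩ V = A ∧ (A ∪ B) ∩ T = B := by
    intro A B hA hB
    rw [Finset.union_inter_distrib_right, Finset.union_inter_distrib_right,
      Finset.inter_eq_left.2 hA, Finset.inter_eq_left.2 hB,
      Finset.disjoint_iff_inter_eq_empty.1 (hVT.symm.mono_left hB),
      Finset.disjoint_iff_inter_eq_empty.1 (hVT.mono_left hA)]
    simp
  obtain ⟨h1, h2⟩ := hcut _ _ (hFV _ hA.1) (hET _ hA.2)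
  obtain ⟨h3, h4⟩ := hcut _ _ (hFV _ hB.1) (hET _ hB.2)
  rw [h] at h1 h2
  exact Prod.ext (h1.symm.trans h3) (h2.symm.trans h4)

lemma exists_overlap_single {i j : ι} (hij : i ≠ j) (T : Finset α) :
    ∃ E : ι → Finset (Finset α), (∀ k, ∀ A ∈ E k, A ⊆ T) ∧
      SymOverlap (Function.update 0 s(i, j) 1) E ∧ ∏ k, (E k).card = 2 ^ T.card * T.card := by
  refine ⟨fun k => if k = i then T.powerset else if k = j then T.powersetCard 1 else {∅},
    ?_, ?_, ?_⟩
  · intro k A hA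
    dsimp only at hA
    split_ifs at hA
    · exact Finset.mem_powerset.1 hA
    · exact (Finset.mem_powersetCard.1 hA).1
    · simp [Finset.mem_singleton.1 hA]
  · intro k l hkl A hA B hB
    dsimp only at hA hB
    by_cases hki : k = i
    · subst hki
      rw [if_neg hkl.symm] at hB
      by_cases hlj : l = j
      · subst hlj
        rw [if_pos rfl, Finset.mem_powersetCard] at hB
        rw [Function.update_self, ← hB.2]
        exact Finset.card_le_card Finset.inter_subset_right
      · rw [if_neg hlj, Finset.mem_singleton] at hB
        simp [hB]
    · rw [if_neg hki] at hA
      by_cases hkj : k = j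
      · subst hkj
        rw [if_pos rfl, Finset.mem_powersetCard] at hA
        by_cases hli : l = i
        · subst hli
          rw [Sym2.eq_swap, Function.update_self, ← hA.2]
          exact Finset.card_le_card Finset.inter_subset_left
        · rw [if_neg hli, if_neg hkl.symm, Finset.mem_singleton] at hB
          simp [hB]
      · rw [if_neg hkj, Finset.mem_singleton] at hA
        simp [hA]
  · have hcard : ∀ k, (if k = i then T.powerset else if k = j then T.powersetCard 1 else
        {∅}).card = (if k = i then 2 ^ T.card else 1) * (if k = j then T.card else 1) := by
      intro k
      by_cases hki : k = i
      · subst hki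
        simp [hij]
      · by_cases hkj : k = j
        · subst hkj
          simp [hki]
        · simp [hki, hkj]
    simp_rw [hcard, Finset.prod_mul_distrib]
    simp

lemma split_bound (W : ℕ) {c u v t a b p : ℝ} (hc : 0 ≤ c) (hu : 0 ≤ u) (ha : 0 ≤ a)
    (hb : 0 ≤ b) (hv : u / 3 ≤ v) (ht : u / 3 ≤ t) (hp : c * v ^ W * a ≤ p) :
    c / 3 ^ (W + 1) * u ^ (W + 1) * (a * b) ≤ p * (b * t) := by
  calc c / 3 ^ (W + 1) * u ^ (W + 1) * (a * b) = (c * (u / 3) ^ W * a) * (b * (u / 3)) := by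
        rw [div_pow, pow_succ, pow_succ]
        field_simp
    _ ≤ (c * v ^ W * a) * (b * t) := by
        have : 0 ≤ v := le_trans (by positivity) hv
        gcongr
    _ ≤ p * (b * t) := by
        have : 0 ≤ t := le_trans (by positivity) ht
        gcongr

/-- The maximal product of sizes of overlapping families has order at least `2 ^ n n ^ W`, where
`W` is the total of the overlap bounds. -/
theorem exists_le_prod_card (ι : Type*) [Fintype ι] [DecidableEq ι] [Nonempty ι] (W : ℕ) :
    ∃ c : ℝ, 0 < c ∧ ∃ N : ℕ, ∀ m : Sym2 ι → ℕ, pairWeight m = W →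
      ∀ (n : ℕ) (U : Finset (Fin n)), N ≤ U.card → ∃ F : ι → Finset (Finset (Fin n)),
        (∀ k, ∀ A ∈ F k, A ⊆ U) ∧ SymOverlap m F ∧
          c * (U.card : ℝ) ^ W * 2 ^ U.card ≤ ∏ k, ((F k).card : ℝ) := by
  induction W with
  | zero =>
    refine ⟨1, one_pos, 0, fun m _ n U _ => ?_⟩
    obtain ⟨i⟩ := ‹Nonempty ι›
    refine ⟨fun k => if k = i then U.powerset else {∅}, ?_, ?_, ?_⟩
    · intro k A hA
      dsimp only at hA
      split_ifs at hA
      · exact Finset.mem_powerset.1 hA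
      · simp [Finset.mem_singleton.1 hA]
    · intro k l hkl A hA B hB
      dsimp only at hA hB
      by_cases hki : k = i
      · rw [if_neg (by rintro rfl; exact hkl hki), Finset.mem_singleton] at hB
        simp [hB]
      · rw [if_neg hki, Finset.mem_singleton] at hA
        simp [hA]
    · have hcard : ∀ k, (((if k = i then U.powerset else {∅} : Finset (Finset (Fin n))).card : ℕ)
          : ℝ) = if k = i then 2 ^ U.card else 1 := by
        intro k
        split_ifs <;> simp
      simp_rw [hcard]
      simp
  | succ W ih =>
    obtain ⟨c, hc, N, hcN⟩ := ih
    refine ⟨c / 3 ^ (W + 1), by positivity, 2 * N + 2, fun m hm n U hU => ?_⟩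
    obtain ⟨i, j, hij, hm1⟩ : ∃ i j : ι, i ≠ j ∧ 1 ≤ m s(i, j) := by
      by_contra! h
      have : pairWeight m = 0 := by
        refine Finset.sum_eq_zero fun S hS => ?_
        induction S with
        | _ i j =>
          have := h i j (by simpa using hS)
          omega
      omega
    obtain ⟨V, hVU, hV⟩ := Finset.exists_subset_card_eq (Nat.div_le_self U.card 2)
    have hT : (U \ V).card = U.card - U.card / 2 := by
      rw [Finset.card_sdiff_of_subset hVU, hV]
    have hVT : Disjoint V (U \ V) := Finset.disjoint_sdiff
    obtain ⟨F, hFV, hF, hFc⟩ := hcN (lowerAt m s(i, j))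
      (by have := pairWeight_lowerAt m hij hm1; omega) n V (by omega)
    obtain ⟨E, hET, hE, hEc⟩ := exists_overlap_single hij (U \ V)
    refine ⟨_, ?_, hF.sups hm1 hVT hFV hET hE, ?_⟩
    · intro k A hA
      obtain ⟨A₁, hA₁, A₂, hA₂, rfl⟩ := Finset.mem_image₂.1 hA
      exact Finset.union_subset ((hFV k _ hA₁).trans hVU) ((hET k _ hA₂).trans Finset.sdiff_subset)
    · simp_rw [card_image₂_union hVT (hFV _) (hET _), Nat.cast_mul, Finset.prod_mul_distrib]
      have hEc' : ∏ k, ((E k).card : ℝ) = 2 ^ (U \ V).card * (U \ V).card := by exact_mod_cast hEc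
      have hV3 : (U.card : ℝ) / 3 ≤ V.card := by
        rw [div_le_iff₀ (by norm_num)]
        exact_mod_cast (by omega : U.card ≤ V.card * 3)
      have hT3 : (U.card : ℝ) / 3 ≤ (U \ V).card := by
        rw [div_le_iff₀ (by norm_num)]
        exact_mod_cast (by omega : U.card ≤ (U \ V).card * 3)
      have hadd : (2 : ℝ) ^ U.card = 2 ^ V.card * 2 ^ (U \ V).card := by
        rw [← pow_add]
        congr 1
        omega
      rw [hEc', hadd]
      have hu : (0 : ℝ) ≤ U.card := Nat.cast_nonneg _
      exact split_bound W hc.le hu (by positivity) (by positivity) hV3 hT3 hFc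

end Overlapping

section ExtremalTuples

variable {n ℓ : ℕ} {m : Fin ℓ → Fin ℓ → ℕ} {F : Fin ℓ → Finset (Finset (Fin n))}

lemma Extremal.card_pos (hF : Extremal m F) (k : Fin ℓ) : 0 < (F k).card := by
  have h := hF.2 (fun _ => {∅}) (by
    intro i j _ A hA B hB
    simp [Finset.mem_singleton.1 hA])
  simp only [Finset.card_singleton, Finset.prod_const_one] at h
  exact Nat.pos_of_ne_zero fun h0 => by
    rw [Finset.prod_eq_zero (Finset.mem_univ k) h0] at h
    omega

/-- In an extremal tuple, every set compatible with the other families is already present. -/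
lemma Extremal.mem_of_forall (hF : Extremal m F) (hsym : ∀ k1 k2, m k1 k2 = m k2 k1) {k : Fin ℓ}
    {A : Finset (Fin n)} (hA : ∀ j, j ≠ k → ∀ B ∈ F j, (A ∩ B).card ≤ m k j) : A ∈ F k := by
  by_contra hAF
  have h := hF.2 (Function.update F k (insert A (F k))) (by
    intro i j hij X hX Y hY
    by_cases hi : i = k
    · subst hi
      rw [Function.update_self, Finset.mem_insert] at hX
      rw [Function.update_of_ne hij.symm] at hY
      rcases hX with rfl | hX
      · exact hA j hij.symm Y hY
      · exact hF.1 i j hij X hX Y hY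
    · rw [Function.update_of_ne hi] at hX
      by_cases hj : j = k
      · subst hj
        rw [Function.update_self, Finset.mem_insert] at hY
        rcases hY with rfl | hY
        · rw [Finset.inter_comm, hsym]
          exact hA i hij X hX
        · exact hF.1 i j hij X hX Y hY
      · rw [Function.update_of_ne hj] at hY
        exact hF.1 i j hij X hX Y hY)
  have hlt : ∏ i, (F i).card < ∏ i, (Function.update F k (insert A (F k)) i).card := by
    refine Finset.prod_lt_prod (fun i _ => hF.card_pos i) (fun i _ => ?_)
      ⟨k, Finset.mem_univ k, ?_⟩
    · by_cases hi : i = k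
      · subst hi
        rw [Function.update_self]
        exact Finset.card_le_card (Finset.subset_insert _ _)
      · rw [Function.update_of_ne hi]
    · rw [Function.update_self, Finset.card_insert_of_notMem hAF]
      exact Nat.lt_succ_self _
  omega

lemma Extremal.mem_of_subset (hF : Extremal m F) (hsym : ∀ k1 k2, m k1 k2 = m k2 k1) {k : Fin ℓ}
    {A B : Finset (Fin n)} (hAB : A ⊆ B) (hB : B ∈ F k) : A ∈ F k :=
  hF.mem_of_forall hsym fun j hj X hX =>
    (Finset.card_le_card (Finset.inter_subset_inter_right hAB)).trans (hF.1 k j hj.symm B hB X hX)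

lemma deg_nonneg (k : Fin ℓ) (S : Finset (Fin n)) : 0 ≤ deg F k S :=
  div_nonneg (Nat.cast_nonneg _) (Nat.cast_nonneg _)

lemma deg_le_one (k : Fin ℓ) (S : Finset (Fin n)) : deg F k S ≤ 1 :=
  div_le_one_of_le₀ (by exact_mod_cast Finset.card_filter_le _ _) (Nat.cast_nonneg _)

lemma card_memberSubfamily_eq (𝒜 : Finset (Finset (Fin n))) (x : Fin n) :
    (𝒜.memberSubfamily x).card = (𝒜.filter (fun A => {x} ⊆ A)).card := by
  have h1 := Finset.card_memberSubfamily_add_card_nonMemberSubfamily x 𝒜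
  have h2 := Finset.card_filter_add_card_filter_not (s := 𝒜) (fun A => x ∈ A)
  simp only [Finset.nonMemberSubfamily] at h1
  simp only [Finset.singleton_subset_iff]
  omega

lemma card_memberSubfamily_div (k : Fin ℓ) (x : Fin n) :
    (((F k).memberSubfamily x).card : ℝ) / (F k).card = deg F k {x} := by
  rw [card_memberSubfamily_eq, deg]

/-- Removing `x` from all families but one, where it is made free, cannot increase the product. -/
lemma Extremal.prod_one_sub_deg_le (hF : Extremal m F) [Nonempty (Fin ℓ)] (x : Fin n) :
    ∏ k, (1 - deg F k {x}) ≤ 1 / 2 := by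
  obtain ⟨i⟩ := ‹Nonempty (Fin ℓ)›
  set N : Fin ℓ → Finset (Finset (Fin n)) := fun k => (F k).nonMemberSubfamily x with hN
  have hNx : ∀ k, ∀ A ∈ N k, A ∈ F k ∧ x ∉ A := fun k A hA => Finset.mem_nonMemberSubfamily.1 hA
  set G : Fin ℓ → Finset (Finset (Fin n)) :=
    fun k => if k = i then N k ∪ (N k).image (insert x) else N k with hG
  have hGN : ∀ k, ∀ A ∈ G k, A.erase x ∈ F k := by
    intro k A hA
    simp only [hG] at hA
    have hNe : ∀ B ∈ N k, B.erase x ∈ F k := fun B hB => by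
      rw [Finset.erase_eq_of_notMem (hNx k B hB).2]
      exact (hNx k B hB).1
    split_ifs at hA
    · rcases Finset.mem_union.1 hA with hA | hA
      · exact hNe A hA
      · obtain ⟨B, hB, rfl⟩ := Finset.mem_image.1 hA
        rw [Finset.erase_insert (hNx k B hB).2]
        exact (hNx k B hB).1
    · exact hNe A hA
  have hGO : Overlap m G := by
    intro k l hkl A hA B hB
    have hx : x ∉ A ∩ B := by
      by_cases hk : k = i
      · have hl : l ≠ i := by rintro rfl; exact hkl hk
        simp only [hG, if_neg hl] at hB
        simp [(hNx l B hB).2]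
      · simp only [hG, if_neg hk] at hA
        simp [(hNx k A hA).2]
    have hsub : A ∩ B ⊆ A.erase x ∩ B.erase x := by
      intro y hy
      have hyx : y ≠ x := by rintro rfl; exact hx hy
      simpa [hyx] using hy
    exact (Finset.card_le_card hsub).trans (hF.1 k l hkl _ (hGN k A hA) _ (hGN l B hB))
  have hGcard : ∀ k, (G k).card = (if k = i then 2 else 1) * (N k).card := by
    intro k
    simp only [hG]
    split_ifs with hk
    · rw [Finset.card_union_of_disjoint, Finset.card_image_of_injOn]
      · ring
      · intro A hA B hB h
        have h : insert x A = insert x B := h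
        rw [← Finset.erase_insert (hNx k A hA).2, h, Finset.erase_insert (hNx k B hB).2]
      · rw [Finset.disjoint_left]
        intro A hA hA'
        obtain ⟨B, -, rfl⟩ := Finset.mem_image.1 hA'
        exact (hNx k _ hA).2 (Finset.mem_insert_self _ _)
    · ring
  have hmax := hF.2 G hGO
  simp_rw [hGcard, Finset.prod_mul_distrib] at hmax
  rw [Finset.prod_ite_eq' Finset.univ i, if_pos (Finset.mem_univ i)] at hmax
  have hmaxR : 2 * ∏ k, ((N k).card : ℝ) ≤ ∏ k, ((F k).card : ℝ) := by exact_mod_cast hmax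
  have hd : ∀ k, 1 - deg F k {x} = ((N k).card : ℝ) / (F k).card := by
    intro k
    have hpos : ((F k).card : ℝ) ≠ 0 := by exact_mod_cast (hF.card_pos k).ne'
    have h1 : ((((F k).memberSubfamily x).card : ℕ) : ℝ) + (N k).card = (F k).card := by
      exact_mod_cast Finset.card_memberSubfamily_add_card_nonMemberSubfamily x (F k)
    rw [← card_memberSubfamily_div, eq_div_iff hpos, sub_mul, div_mul_cancel₀ _ hpos]
    linarith
  have hP : 0 < ∏ k, ((F k).card : ℝ) :=
    Finset.prod_pos fun k _ => by exact_mod_cast hF.card_pos k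
  simp_rw [hd]
  rw [Finset.prod_div_distrib, div_le_iff₀ hP]
  linarith

/-- Adding to `T` an element of degree at least `1 / 2 - ε` nearly halves the degree of `T`, in the
worst case. -/
lemma deg_insert_ge {k : Fin ℓ} (hpos : 0 < (F k).card)
    (hdown : ∀ A B : Finset (Fin n), A ⊆ B → B ∈ F k → A ∈ F k) {ε : ℝ} (x : Fin n)
    (hx : 1 / 2 - ε ≤ deg F k {x}) (T : Finset (Fin n)) :
    deg F k T / 2 - ε ≤ deg F k (insert x T) := by
  set N := (F k).nonMemberSubfamily x with hN
  set M := (F k).memberSubfamily x with hM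
  have hMN : M ⊆ N := fun A hA => by
    rw [hM, Finset.mem_memberSubfamily] at hA
    exact Finset.mem_nonMemberSubfamily.2 ⟨hdown _ _ (Finset.subset_insert x A) hA.1, hA.2⟩
  have hcard : M.card + N.card = (F k).card :=
    Finset.card_memberSubfamily_add_card_nonMemberSubfamily x (F k)
  have hinj : (M.filter (fun A => T ⊆ insert x A)).card ≤
      ((F k).filter (fun A => insert x T ⊆ A)).card := by
    refine Finset.card_le_card_of_injOn (insert x) ?_ ?_
    · intro A hA
      simp only [Finset.coe_filter, Set.mem_ofPred_eq, hM, Finset.mem_memberSubfamily] at hA ⊢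
      exact ⟨hA.1.1, Finset.insert_subset (Finset.mem_insert_self _ _) hA.2⟩
    · intro A hA B hB h
      simp only [Finset.coe_filter, Set.mem_ofPred_eq, hM, Finset.mem_memberSubfamily] at hA hB
      have h : insert x A = insert x B := h
      rw [← Finset.erase_insert hA.1.2, h, Finset.erase_insert hB.1.2]
  have hsub : (F k).filter (fun A => T ⊆ A) ⊆
      (F k).filter (fun A => insert x T ⊆ A) ∪
        (M.filter (fun A => T ⊆ insert x A) ∪ (N \ M)) := by
    intro A hA
    rw [Finset.mem_filter] at hA
    by_cases hxA : x ∈ A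
    · exact Finset.mem_union_left _ (Finset.mem_filter.2 ⟨hA.1, Finset.insert_subset hxA hA.2⟩)
    · refine Finset.mem_union_right _ ?_
      by_cases hAM : A ∈ M
      · exact Finset.mem_union_left _
          (Finset.mem_filter.2 ⟨hAM, hA.2.trans (Finset.subset_insert _ _)⟩)
      · exact Finset.mem_union_right _
          (Finset.mem_sdiff.2 ⟨Finset.mem_nonMemberSubfamily.2 ⟨hA.1, hxA⟩, hAM⟩)
  have h1 := (Finset.card_le_card hsub).trans ((Finset.card_union_le _ _).trans
    (Nat.add_le_add_left (Finset.card_union_le _ _) _))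
  rw [Finset.card_sdiff_of_subset hMN] at h1
  have h2 : ((F k).filter (fun A => T ⊆ A)).card + 2 * M.card ≤
      2 * ((F k).filter (fun A => insert x T ⊆ A)).card + (F k).card := by
    have := Finset.card_le_card hMN
    omega
  have hposR : (0 : ℝ) < (F k).card := by exact_mod_cast hpos
  have h2R : (((F k).filter (fun A => T ⊆ A)).card : ℝ) + 2 * M.card ≤
      2 * ((F k).filter (fun A => insert x T ⊆ A)).card + (F k).card := by exact_mod_cast h2
  have h3 : deg F k T + 2 * deg F k {x} ≤ 2 * deg F k (insert x T) + 1 := by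
    rw [← card_memberSubfamily_div, deg, deg]
    have := div_le_div_of_nonneg_right h2R hposR.le
    rw [add_div, add_div, mul_div_assoc, mul_div_assoc, div_self hposR.ne'] at this
    exact this
  linarith

lemma deg_ge_of_subset_center {k : Fin ℓ} (hpos : 0 < (F k).card)
    (hdown : ∀ A B : Finset (Fin n), A ⊆ B → B ∈ F k → A ∈ F k) {ε : ℝ} (hε : 0 ≤ ε)
    (T : Finset (Fin n)) (hT : T ⊆ center F ε k) :
    1 / 2 ^ T.card - T.card * ε ≤ deg F k T := by
  induction T using Finset.induction_on with
  | empty =>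
    have hposR : ((F k).card : ℝ) ≠ 0 := by exact_mod_cast hpos.ne'
    simp [deg, div_self hposR]
  | insert x T hx ih =>
    have h1 := ih ((Finset.subset_insert _ _).trans hT)
    have h2 : 1 / 2 - ε ≤ deg F k {x} :=
      (Finset.mem_filter.1 (hT (Finset.mem_insert_self _ _))).2
    have h3 := deg_insert_ge hpos hdown x h2 T
    rw [Finset.card_insert_of_notMem hx, pow_succ, ← div_div]
    have : 0 ≤ (T.card : ℝ) * ε := by positivity
    push_cast
    linarith

lemma Extremal.center_mem (hF : Extremal m F) (hsym : ∀ k1 k2, m k1 k2 = m k2 k1) {ε : ℝ}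
    (hε : 0 ≤ ε) (W : ℕ) (hW : ∀ i j, i ≠ j → m i j ≤ W)
    (hsmall : (W + 1) * ε < 1 / 2 ^ (W + 1)) (k : Fin ℓ) : center F ε k ∈ F k := by
  refine hF.mem_of_forall hsym fun j hj B hB => ?_
  by_contra! hlt
  obtain ⟨T, hT, hTcard⟩ := Finset.exists_subset_card_eq (Nat.succ_le_of_lt hlt)
  have hmW := hW k j hj.symm
  have hd := deg_ge_of_subset_center (hF.card_pos k)
    (fun _ _ h => hF.mem_of_subset hsym h) hε T (hT.trans Finset.inter_subset_left)
  have hpos : 0 < deg F k T := by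
    have h1 : (T.card : ℝ) * ε ≤ (W + 1) * ε := by
      gcongr
      exact_mod_cast (by omega : T.card ≤ W + 1)
    have h2 : (1 : ℝ) / 2 ^ (W + 1) ≤ 1 / 2 ^ T.card := by
      gcongr
      · norm_num
      · omega
    linarith
  have hne : ((F k).filter (fun A => T ⊆ A)).card ≠ 0 := by
    intro h0
    simp [deg, h0] at hpos
  obtain ⟨A, hA⟩ := Finset.card_pos.1 (Nat.pos_of_ne_zero hne)
  rw [Finset.mem_filter] at hA
  have := hF.1 k j hj.symm A hA.1 B hB
  have := Finset.card_le_card (Finset.subset_inter hA.2 (hT.trans Finset.inter_subset_right))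
  omega

lemma upper_le_ratio_mul_lower (w : ℕ) {K c u a p : ℝ} (hK : 0 ≤ K) (hc : 0 < c) (hu : 1 ≤ u)
    (ha : 0 ≤ a) (hp : c * u ^ (w + 1) * a ≤ p) :
    K * (u + 1) ^ w * a ≤ K * 2 ^ w / c / u * p := by
  have hu0 : 0 < u := by linarith
  calc K * (u + 1) ^ w * a ≤ K * (2 * u) ^ w * a := by
        gcongr
        linarith
    _ = (K * 2 ^ w / c / u) * (c * u ^ (w + 1) * a) := by
        rw [mul_pow, pow_succ]
        field_simp
    _ ≤ _ := by gcongr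

/-- No element has large degree in two families of an extremal tuple. -/
theorem exists_deg_mul_deg_le (ℓ : ℕ) [Nonempty (Fin ℓ)] (m : Fin ℓ → Fin ℓ → ℕ)
    (hsym : ∀ k1 k2, m k1 k2 = m k2 k1) :
    ∃ D : ℝ, 0 < D ∧ ∃ N : ℕ, ∀ n : ℕ, N ≤ n → ∀ F : Fin ℓ → Finset (Finset (Fin n)),
      Extremal m F → ∀ x : Fin n, ∀ i j : Fin ℓ, i ≠ j →
        deg F i {x} * deg F j {x} ≤ D / n := by
  obtain ⟨m', hm'⟩ : ∃ m' : Sym2 (Fin ℓ) → ℕ, ∀ i j, m' s(i, j) = m i j :=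
    ⟨Sym2.lift ⟨m, hsym⟩, fun i j => rfl⟩
  obtain ⟨W, hW⟩ : ∃ W, pairWeight m' = W := ⟨_, rfl⟩
  obtain ⟨K, hK, hupper⟩ := exists_prod_card_le_s9 (Fin ℓ) (W - 1)
  obtain ⟨c, hc, N, hlower⟩ := exists_le_prod_card (Fin ℓ) W
  refine ⟨K * 2 ^ (W - 1) / c, by positivity, N + 1, fun n hn F hF x i j hij => ?_⟩
  have hn0 : (0 : ℝ) < n := by exact_mod_cast (by omega : 0 < n)
  have hn1 : (1 : ℝ) ≤ n := by exact_mod_cast (by omega : 1 ≤ n)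
  have hP : 0 < ∏ k, ((F k).card : ℝ) :=
    Finset.prod_pos fun k _ => by exact_mod_cast hF.card_pos k
  have hiff : ∀ G : Fin ℓ → Finset (Finset (Fin n)), SymOverlap m' G ↔ Overlap m G := by
    simp only [SymOverlap, Overlap, hm', implies_true]
  have hFO : SymOverlap m' F := (hiff F).2 hF.1
  obtain ⟨G, -, hGO, hG⟩ := hlower m' hW n Finset.univ (by simp; omega)
  have hGF : ∏ k, ((G k).card : ℝ) ≤ ∏ k, ((F k).card : ℝ) := by
    exact_mod_cast hF.2 G ((hiff G).1 hGO)
  have hPlow := hG.trans hGF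
  rw [Finset.card_univ, Fintype.card_fin] at hPlow
  have hlink := hFO.prod_link_le (x := x) (G := F) (H := fun k => (F k).memberSubfamily x)
    (fun k A hA => ⟨A, hA, subset_rfl⟩) (fun k A hA => Finset.mem_memberSubfamily.1 hA) hij
    ((K * 2 ^ (W - 1) / c / n) * ∏ k, ((F k).card : ℝ)) (by positivity) (by
      intro hm1 hO
      have hw := pairWeight_lowerAt m' hij hm1
      refine (hupper _ (by omega) n Finset.univ _ (fun _ _ _ => Finset.subset_univ _) hO).trans ?_
      obtain ⟨w, hw'⟩ : ∃ w, W = w + 1 := ⟨_, hW ▸ hw.symm⟩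
      rw [hw'] at hPlow ⊢
      rw [Finset.card_univ, Fintype.card_fin, Nat.add_sub_cancel]
      exact upper_le_ratio_mul_lower w hK.le hc hn1 (by positivity) hPlow)
  rw [prod_ite_pair (fun k => ((F k).card : ℝ)) (fun k => (((F k).memberSubfamily x).card : ℝ))
    (fun k => by exact_mod_cast hF.card_pos k) hij] at hlink
  simp only [card_memberSubfamily_div] at hlink
  rw [mul_comm] at hlink
  exact le_of_mul_le_mul_right hlink hP

end ExtremalTuples

/-- probabilistic centers, Lemma 11 of the paper. For fixed `ℓ ≥ 2`
and symmetric `𝐦` there are `C > 0` and `N` such that for every `n ≥ N` and extremal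
`𝐦`-overlapping tuple `𝓕` on `[n]`, with `C*_k = {x : d_k(x) ≥ 1/2 − C/n}`:
each `C*_k` belongs to `𝓕_k`, they are pairwise disjoint, and they cover `[n]`. -/
theorem probabilistic_centers (ℓ : ℕ) (hℓ : 2 ≤ ℓ) (m : Fin ℓ → Fin ℓ → ℕ)
    (hsym : ∀ k1 k2, m k1 k2 = m k2 k1) :
    ∃ C : ℝ, 0 < C ∧ ∃ N : ℕ, ∀ n : ℕ, N ≤ n →
      ∀ F : Fin ℓ → Finset (Finset (Fin n)), Extremal m F →
        (∀ k : Fin ℓ, center F (C / n) k ∈ F k) ∧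
        (∀ k1 k2 : Fin ℓ, k1 ≠ k2 → Disjoint (center F (C / n) k1) (center F (C / n) k2)) ∧
        (Finset.univ.biUnion (center F (C / n)) = (Finset.univ : Finset (Fin n))) := by
  have : Nonempty (Fin ℓ) := ⟨⟨0, by omega⟩⟩
  obtain ⟨D, hD, N, hDN⟩ := exists_deg_mul_deg_le ℓ m hsym
  set W : ℕ := ∑ i, ∑ j, m i j with hW
  have hmW : ∀ i j, i ≠ j → m i j ≤ W := fun i j _ =>
    (Finset.single_le_sum (f := fun j => m i j) (fun _ _ => Nat.zero_le _)
      (Finset.mem_univ j)).trans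
      (Finset.single_le_sum (f := fun i => ∑ j, m i j) (fun _ _ => Nat.zero_le _)
        (Finset.mem_univ i))
  have hℓ0 : (0 : ℝ) < ℓ := by exact_mod_cast (by omega : 0 < ℓ)
  set C : ℝ := 2 * (ℓ : ℝ) ^ 2 * D with hC
  have hC0 : 0 < C := by positivity
  obtain ⟨N', hN'⟩ := exists_nat_gt (4 * C + 16 * D + C * (W + 1) * 2 ^ (W + 1))
  refine ⟨C, hC0, N + N' + 1, fun n hn F hF => ?_⟩
  have hn0 : (0 : ℝ) < n := by exact_mod_cast (by omega : 0 < n)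
  have hnN' : (N' : ℝ) ≤ n := by exact_mod_cast (by omega : N' ≤ n)
  have hp : 0 < C * (W + 1) * 2 ^ (W + 1) := by positivity
  have hdd := hDN n (by omega) F hF
  refine ⟨hF.center_mem hsym (by positivity) W hmW ?_, fun k1 k2 hk => ?_, ?_⟩
  · rw [lt_div_iff₀ (by positivity), mul_div_assoc', div_mul_eq_mul_div, div_lt_one hn0]
    linarith
  · rw [Finset.disjoint_left]
    intro x h1 h2
    have h1 := (Finset.mem_filter.1 h1).2
    have h2 := (Finset.mem_filter.1 h2).2
    have hCn : C / n ≤ 1 / 4 := by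
      rw [div_le_iff₀ hn0]
      linarith
    have hDn : D / n < 1 / 16 := by
      rw [div_lt_iff₀ hn0]
      linarith
    nlinarith [hdd x k1 k2 hk]
  · refine Finset.eq_univ_of_forall fun x => ?_
    have hsum : 1 / 2 ≤ ∑ k, deg F k {x} := by
      have h1 := one_sub_sum_le_prod_one_sub Finset.univ (fun k => deg F k {x})
        (fun k => deg_nonneg k _) fun k => deg_le_one k _
      linarith [hF.prod_one_sub_deg_le x]
    obtain ⟨i, hi⟩ := exists_sum_le_add (fun k => deg F k {x}) (D / n) (1 / 2) (by norm_num)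
      (fun k => deg_nonneg k _) (by positivity) (hdd x) hsum
    refine Finset.mem_biUnion.2 ⟨i, Finset.mem_univ i, Finset.mem_filter.2 ⟨Finset.mem_univ x, ?_⟩⟩
    have hCD : (Fintype.card (Fin ℓ) : ℝ) ^ 2 * (D / n) / (1 / 2) = C / n := by
      rw [Fintype.card_fin, hC]
      field_simp
    rw [hCD] at hi
    linarith

end
end
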